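/- arXiv:1502.05123 — 6 statements merged into one kernel-verified Lean document; each statement's English description precedes it below -/
import Mathlib

section
/- Let c ∈ ℂ with Re c > 0, let 0 < α ≤ 1, and let n be a positive integer. Then the generalized open door function R_{α,c,n} is univalent (i.e. injective and holomorphic) on 𝔻. -/
open Complex Metric Set

/-- `g_c(z) = (c + c̄z)/(1 − z)`. -/
noncomputable def gc (c : ℂ) (z : ℂ) : ℂ := (c + (starRingEnd ℂ) c * z) / (1 - z)

/-- The generalized open door function
`R_{α,c,n}(z) = ((c + c̄z)/(1 − z))^α + 2nα(Re c)z/((1 − z)(c + c̄z))`,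
where the power is the principal power (which agrees with `exp(α log g_c)` for the
branch with `|Im log g_c| < π/2`, since `g_c` takes values in the right half-plane). -/
noncomputable def Rgen (α : ℝ) (c : ℂ) (n : ℕ) (z : ℂ) : ℂ :=
  gc c z ^ (α : ℂ) +
    2 * (n : ℂ) * (α : ℂ) * (c.re : ℂ) * z / ((1 - z) * (c + (starRingEnd ℂ) c * z))

lemma re_segment_pos {u v : ℂ} (hu : 0 < u.re) (hv : 0 < v.re) {t : ℝ} (ht0 : 0 ≤ t)
    (ht1 : t ≤ 1) : 0 < (u + t * (v - u)).re := by
  have hre : (u + t * (v - u)).re = u.re + t * (v.re - u.re) := by simp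
  rw [hre]
  rcases ht0.eq_or_lt with rfl | h
  · simpa using hu
  · nlinarith [mul_pos h hv, mul_nonneg (sub_nonneg.2 ht1) hu.le]

lemma im_half_log_add_log (u v : ℂ) : ((log u + log v) / 2).im = (arg u + arg v) / 2 := by
  rw [show (2 : ℂ) = ((2 : ℝ) : ℂ) by norm_num, div_ofReal_im, add_im, log_im, log_im]

lemma arg_eq_arctan_of_re_pos {w : ℂ} (hw : 0 < w.re) : arg w = Real.arctan (w.im / w.re) := by
  have h := abs_lt.1 (abs_arg_lt_pi_div_two_iff.2 (Or.inl hw))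
  rw [← Complex.tan_arg, Real.arctan_tan h.1 h.2]

/-- In the right half-plane, the argument along a segment stays between the arguments of the
endpoints. -/
lemma arg_segment_mem_Icc {u v : ℂ} (hu : 0 < u.re) (hv : 0 < v.re) (huv : arg u ≤ arg v)
    {t : ℝ} (ht0 : 0 ≤ t) (ht1 : t ≤ 1) : arg (u + t * (v - u)) ∈ Icc (arg u) (arg v) := by
  have hre : (u + t * (v - u)).re = u.re + t * (v.re - u.re) := by simp
  have him : (u + t * (v - u)).im = u.im + t * (v.im - u.im) := by simp
  have hpos : 0 < u.re + t * (v.re - u.re) := hre ▸ re_segment_pos hu hv ht0 ht1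
  rw [arg_eq_arctan_of_re_pos hu, arg_eq_arctan_of_re_pos hv] at huv ⊢
  rw [arg_eq_arctan_of_re_pos (hre ▸ hpos), hre, him]
  have hslope : u.im / u.re ≤ v.im / v.re := Real.arctan_strictMono.le_iff_le.1 huv
  rw [div_le_div_iff₀ hu hv] at hslope
  constructor <;> apply Real.arctan_strictMono.monotone
  · rw [div_le_div_iff₀ hu hpos]
    nlinarith
  · rw [div_le_div_iff₀ hpos hv]
    nlinarith

/-- The square root `exp ((log u + log v) / 2)` of `u * v` rotates the divided difference of
`w ↦ w ^ α` at `u, v` into the right half-plane. -/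
lemma re_exp_mul_divided_difference_pos {u v : ℂ} (hu : 0 < u.re) (hv : 0 < v.re)
    (huv : u ≠ v) (harg : arg u ≤ arg v) {α : ℝ} (hα : 0 < α) (hα1 : α ≤ 1) :
    0 < (exp ((log u + log v) / 2) * ((v ^ (α : ℂ) - u ^ (α : ℂ)) / (v - u))).re := by
  set s : ℂ := exp ((log u + log v) / 2) with hs
  have hvu : v - u ≠ 0 := sub_ne_zero.2 huv.symm
  have hre : ∀ t ∈ Icc (0 : ℝ) 1, 0 < (u + t * (v - u)).re :=
    fun t ht => re_segment_pos hu hv ht.1 ht.2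
  have hderiv : ∀ t ∈ Icc (0 : ℝ) 1,
      HasDerivAt (fun t : ℝ => (s * ((u + t * (v - u)) ^ (α : ℂ) / (v - u))).re)
        (s * (α * (u + t * (v - u)) ^ ((α : ℂ) - 1))).re t := by
    intro t ht
    have h1 : HasDerivAt (fun z : ℂ => u + z * (v - u)) (v - u) (t : ℂ) := by
      simpa using ((hasDerivAt_id (t : ℂ)).mul_const (v - u)).const_add u
    have h2 := ((h1.cpow_const (c := (α : ℂ)) (Or.inl (hre t ht))).div_const (v - u)).const_mul s
    have h3 := h2.real_of_complex
    rwa [mul_div_cancel_right₀ _ hvu] at h3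
  obtain ⟨t, ht, hmvt⟩ := exists_hasDerivAt_eq_slope
    (fun t : ℝ => (s * ((u + t * (v - u)) ^ (α : ℂ) / (v - u))).re) _ zero_lt_one
    (fun t ht => (hderiv t ht).continuousAt.continuousWithinAt)
    (fun t ht => hderiv t (Ioo_subset_Icc_self ht))
  have hgoal : (s * ((v ^ (α : ℂ) - u ^ (α : ℂ)) / (v - u))).re =
      (s * (α * (u + t * (v - u)) ^ ((α : ℂ) - 1))).re := by
    rw [hmvt, sub_div, mul_sub, sub_re]
    simp
  have hpt := hre t (Ioo_subset_Icc_self ht)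
  have hmem := arg_segment_mem_Icc hu hv harg ht.1.le ht.2.le
  set w := u + t * (v - u)
  have hw0 : w ≠ 0 := fun h => by simp [h] at hpt
  have hexp : s * (α * w ^ ((α : ℂ) - 1)) =
      α * exp ((log u + log v) / 2 + log w * ((α : ℂ) - 1)) := by
    rw [cpow_def_of_ne_zero hw0, exp_add, hs]
    ring
  have him : ((log u + log v) / 2 + log w * ((α : ℂ) - 1)).im =
      (arg u + arg v) / 2 + arg w * (α - 1) := by
    rw [add_im, im_half_log_add_log, show (α : ℂ) - 1 = ((α - 1 : ℝ) : ℂ) by push_cast; rfl,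
      im_mul_ofReal, log_im]
  rw [hgoal, hexp, re_ofReal_mul, exp_re, him]
  have hau := abs_lt.1 (abs_arg_lt_pi_div_two_iff.2 (Or.inl hu))
  have hav := abs_lt.1 (abs_arg_lt_pi_div_two_iff.2 (Or.inl hv))
  refine mul_pos hα (mul_pos (Real.exp_pos _) (Real.cos_pos_of_mem_Ioo ⟨?_, ?_⟩))
  · nlinarith [mul_nonneg (sub_nonneg.2 hα1) (sub_nonneg.2 hmem.2),
      mul_nonneg hα.le (sub_nonneg.2 harg)]
  · nlinarith [mul_nonneg (sub_nonneg.2 hα1) (sub_nonneg.2 hmem.1),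
      mul_nonneg hα.le (sub_nonneg.2 harg)]

lemma injOn_cpow_add_mul_sub_div {α : ℝ} (hα : 0 < α) (hα1 : α ≤ 1) {K r : ℝ} (hK : 0 < K)
    (hr : 0 ≤ r) :
    InjOn (fun w : ℂ => w ^ (α : ℂ) + K * (w - r / w)) {w | 0 < w.re} := by
  intro u hu v hv huv
  by_contra hne
  wlog harg : arg u ≤ arg v generalizing u v
  · exact this hv hu huv.symm (Ne.symm hne) (le_of_not_ge harg)
  change 0 < u.re at hu
  change 0 < v.re at hv
  have hu0 : u ≠ 0 := fun h => by simp [h] at hu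
  have hv0 : v ≠ 0 := fun h => by simp [h] at hv
  have hvu : v - u ≠ 0 := sub_ne_zero.2 (Ne.symm hne)
  have hpos := re_exp_mul_divided_difference_pos hu hv hne harg hα hα1
  set s : ℂ := exp ((log u + log v) / 2) with hs
  have hs0 : s ≠ 0 := exp_ne_zero _
  have hss : s * s = u * v := by
    rw [hs, ← exp_add, add_halves, exp_add, exp_log hu0, exp_log hv0]
  have hsre : 0 < s.re := by
    have hau := abs_lt.1 (abs_arg_lt_pi_div_two_iff.2 (Or.inl hu))
    have hav := abs_lt.1 (abs_arg_lt_pi_div_two_iff.2 (Or.inl hv))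
    rw [hs, exp_re, im_half_log_add_log]
    exact mul_pos (Real.exp_pos _) (Real.cos_pos_of_mem_Ioo ⟨by linarith, by linarith⟩)
  have hdiff : (v ^ (α : ℂ) - u ^ (α : ℂ)) / (v - u) = -(K * (1 + r / (u * v))) := by
    rw [div_eq_iff hvu]
    have h : v ^ (α : ℂ) - u ^ (α : ℂ) = K * (u - r / u) - K * (v - r / v) := by
      linear_combination -huv
    rw [h]
    field_simp
    ring
  have hkey : s * ((v ^ (α : ℂ) - u ^ (α : ℂ)) / (v - u)) =
      -((K : ℝ) * (s + (r : ℝ) * s⁻¹)) := by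
    rw [hdiff, ← hss]
    field_simp
  have hinv : 0 ≤ (s⁻¹).re := by
    rw [inv_re]
    exact div_nonneg hsre.le (normSq_nonneg s)
  rw [hkey, neg_re, re_ofReal_mul, add_re, re_ofReal_mul] at hpos
  have : 0 < K * (s.re + r * (s⁻¹).re) := by positivity
  linarith

lemma one_sub_ne_zero_of_mem_ball {z : ℂ} (hz : z ∈ ball (0 : ℂ) 1) : 1 - z ≠ 0 := by
  intro h
  rw [← sub_eq_zero.1 h] at hz
  simp at hz

lemma gc_re_pos {c z : ℂ} (hc : 0 < c.re) (hz : z ∈ ball (0 : ℂ) 1) : 0 < (gc c z).re := by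
  have h1 : 0 < normSq (1 - z) := normSq_pos.2 (one_sub_ne_zero_of_mem_ball hz)
  have hz2 : normSq z < 1 := by
    rw [mem_ball_zero_iff] at hz
    rw [normSq_eq_norm_sq]
    nlinarith [norm_nonneg z]
  rw [normSq_apply] at hz2
  have h2 : (gc c z).re = c.re * (1 - (z.re * z.re + z.im * z.im)) / normSq (1 - z) := by
    rw [gc, div_re, ← add_div]
    congr 1
    simp
    ring
  rw [h2]
  exact div_pos (mul_pos hc (by linarith)) h1

lemma gc_numerator_ne_zero {c z : ℂ} (hc : 0 < c.re) (hz : z ∈ ball (0 : ℂ) 1) :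
    c + (starRingEnd ℂ) c * z ≠ 0 := by
  intro h
  have := gc_re_pos hc hz
  simp [gc, h] at this

lemma gc_injOn {c : ℂ} (hc : 0 < c.re) : InjOn (gc c) (ball 0 1) := by
  intro z hz w hw h
  rw [gc, gc, div_eq_div_iff (one_sub_ne_zero_of_mem_ball hz) (one_sub_ne_zero_of_mem_ball hw)] at h
  have hcc : c + (starRingEnd ℂ) c ≠ 0 := by
    rw [add_conj]
    exact_mod_cast (mul_pos two_pos hc).ne'
  exact mul_left_cancel₀ hcc (by linear_combination h)

lemma gc_differentiableOn (c : ℂ) : DifferentiableOn ℂ (gc c) (ball 0 1) := by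
  unfold gc
  exact DifferentiableOn.div (by fun_prop) (by fun_prop)
    fun z hz => one_sub_ne_zero_of_mem_ball hz

/-- The open door function as a function of `w = gc c z` in the right half-plane. -/
lemma Rgen_eq_of_gc {c z : ℂ} (hc : 0 < c.re) (hz : z ∈ ball (0 : ℂ) 1) (α : ℝ) (n : ℕ) :
    Rgen α c n z = gc c z ^ (α : ℂ) +
      ((n * α / (2 * c.re) : ℝ) : ℂ) * (gc c z - ((normSq c : ℝ) : ℂ) / gc c z) +
      ((n * α / (2 * c.re) : ℝ) : ℂ) * ((starRingEnd ℂ) c - c) := by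
  have h1 := one_sub_ne_zero_of_mem_ball hz
  have h2 := gc_numerator_ne_zero hc hz
  have h3 : (c.re : ℂ) = (c + (starRingEnd ℂ) c) / 2 := re_eq_add_conj c
  have h4 : c + (starRingEnd ℂ) c ≠ 0 := by
    rw [add_conj]
    exact_mod_cast (mul_pos two_pos hc).ne'
  rw [Rgen, add_assoc, add_right_inj, ← mul_conj]
  unfold gc
  push_cast
  rw [h3]
  generalize (starRingEnd ℂ) c = d at *
  field_simp
  ring

/-- The generalized open door function is univalent (holomorphic and injective) on `𝔻`. -/
theorem Rgen_univalent (c : ℂ) (hc : 0 < c.re) (α : ℝ) (hα : 0 < α) (hα1 : α ≤ 1)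
    (n : ℕ) (hn : 0 < n) :
    DifferentiableOn ℂ (Rgen α c n) (ball 0 1) ∧ Set.InjOn (Rgen α c n) (ball 0 1) := by
  constructor
  · unfold Rgen
    refine DifferentiableOn.add ?_ (DifferentiableOn.div (by fun_prop) (by fun_prop) ?_)
    · exact (gc_differentiableOn c).cpow (differentiableOn_const _)
        fun z hz => Or.inl (gc_re_pos hc hz)
    · exact fun z hz => mul_ne_zero (one_sub_ne_zero_of_mem_ball hz) (gc_numerator_ne_zero hc hz)
  · intro z hz w hw h
    rw [Rgen_eq_of_gc hc hz, Rgen_eq_of_gc hc hw, add_left_inj] at h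
    have hK : 0 < n * α / (2 * c.re) := by positivity
    exact gc_injOn hc hz hw
      (injOn_cpow_add_mul_sub_div hα hα1 hK (normSq_nonneg c) (gc_re_pos hc hz)
        (gc_re_pos hc hw) h)
end

section
/- Let c ∈ ℂ with Re c > 0, let 0 < α ≤ 1, and let n be a positive integer. If a function q ∈ H[c^α, n] satisfies q(z) ≠ 0 for all z ∈ 𝔻 and q(z) + z·q′(z)/q(z) ∈ R_{α,c,n}(𝔻) for all z ∈ 𝔻 (where R_{α,c,n}(𝔻) denotes the image of 𝔻 under R_{α,c,n}), then |arg q(z)| < πα/2 for all z ∈ 𝔻. -/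
open Complex Metric Set Real

open Filter Topology Asymptotics

/-- A nonvanishing holomorphic function on the unit disk has a holomorphic logarithm with a
prescribed value at the origin. -/
lemma exists_log_on_unit_ball {f : ℂ → ℂ} (hf : DifferentiableOn ℂ f (ball 0 1))
    (hne : ∀ z ∈ ball (0 : ℂ) 1, f z ≠ 0) {a : ℂ} (ha : f 0 = cexp a) :
    ∃ h : ℂ → ℂ, h 0 = a ∧ ∀ z ∈ ball (0 : ℂ) 1,
      HasDerivAt h (deriv f z / f z) z ∧ f z = cexp (h z) := by
  obtain ⟨h, h0, hd⟩ := ((hf.deriv isOpen_ball).div hf hne).isExactOn_ball.with_val_at 0 a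
  refine ⟨h, h0, fun z hz => ⟨hd z hz, ?_⟩⟩
  have hder : ∀ z ∈ ball (0 : ℂ) 1, HasDerivAt (fun z => f z * cexp (-h z)) 0 z := by
    intro z hz
    have h1 := (hf.differentiableAt (isOpen_ball.mem_nhds hz)).hasDerivAt.mul (hd z hz).neg.cexp
    refine h1.congr_deriv ?_
    have := hne z hz
    simp only [Pi.div_apply]
    field_simp
    ring
  have hconst := isOpen_ball.is_const_of_deriv_eq_zero (convex_ball (0 : ℂ) 1).isPreconnected
    (fun z hz => (hder z hz).differentiableAt.differentiableWithinAt)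
    (fun z hz => (hder z hz).deriv) hz (mem_ball_self one_pos)
  simp only [h0, ha, ← Complex.exp_add, add_neg_cancel, Complex.exp_zero] at hconst
  rwa [Complex.exp_neg, ← div_eq_mul_inv, div_eq_one_iff_eq (Complex.exp_ne_zero _)] at hconst

/-- A function that is nonnegative on `(0, 1)` and vanishes at `1` has nonpositive derivative at `1`. -/
lemma hasDerivAt_nonpos_of_nonneg_left {f : ℝ → ℝ} {f' : ℝ} (hf : HasDerivAt f f' 1)
    (h1 : f 1 = 0) (hpos : ∀ t ∈ Ioo (0 : ℝ) 1, 0 ≤ f t) : f' ≤ 0 := by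
  have h := (hasDerivWithinAt_iff_tendsto_slope' (s := Iio (1 : ℝ)) (by simp)).1
    hf.hasDerivWithinAt
  refine le_of_tendsto h ?_
  filter_upwards [Ioo_mem_nhdsLT (zero_lt_one' ℝ)] with t ht
  rw [slope_def_field, h1, sub_zero]
  exact div_nonpos_of_nonneg_of_nonpos (hpos t ht) (by linarith [ht.2])

/-- Radial part of **Jack's lemma**. -/
lemma jack_radial {w : ℂ → ℂ} {w' z₀ : ℂ} {n : ℕ} (hn : 0 < n) (hz₀ : z₀ ≠ 0)
    (hd : DifferentiableOn ℂ w (ball 0 ‖z₀‖))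
    (hmaps : MapsTo w (ball 0 ‖z₀‖) (closedBall 0 1)) (hw0 : w 0 = 0)
    (hO : w =O[𝓝 0] fun z => z ^ n) (hw' : HasDerivAt w w' z₀) (hnorm : ‖w z₀‖ = 1) :
    (n : ℝ) ≤ (z₀ * w' / w z₀).re := by
  have hr : 0 < ‖z₀‖ := norm_pos_iff.2 hz₀
  obtain ⟨m, rfl⟩ : ∃ m, n = m + 1 := ⟨n - 1, by omega⟩
  have hbound : ∀ z ∈ ball (0 : ℂ) ‖z₀‖, ‖w z‖ ≤ (‖z‖ / ‖z₀‖) ^ (m + 1) := by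
    intro z hz
    have := dist_le_mul_div_pow_of_mapsTo_ball_of_isLittleO (f := w) (c := 0) (R₂ := 1) (n := m)
      hd (by rwa [hw0]) ?_ hz
    · simpa [hw0] using this
    · have hlo := hO.trans_isLittleO (isLittleO_pow_pow (𝕜 := ℂ) m.lt_succ_self)
      simpa [hw0] using hlo.norm_right
  have hline : HasDerivAt (fun t : ℝ => w (t * z₀)) (z₀ * w') 1 := by
    have h1 : HasDerivAt (fun t : ℝ => (t : ℂ) * z₀) (1 * z₀) 1 :=
      (Complex.ofRealCLM.hasDerivAt (x := (1 : ℝ))).mul_const z₀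
    have h2 : HasDerivAt w w' (((1 : ℝ) : ℂ) * z₀) := by simpa using hw'
    simpa [Function.comp_def, mul_comm] using h2.comp (1 : ℝ) h1
  have hpow : HasDerivAt (fun t : ℝ => (t ^ (m + 1)) ^ 2)
      (2 * ((m + 1 : ℕ) : ℝ)) 1 := by
    refine (((hasDerivAt_id' (1 : ℝ)).fun_pow (m + 1)).fun_pow 2).congr_deriv ?_
    simp
  have key := hasDerivAt_nonpos_of_nonneg_left (hpow.sub hline.norm_sq) (by simp [hnorm]) ?_
  · have hinv : z₀ * w' / w z₀ = (starRingEnd ℂ) (w z₀) * (z₀ * w') := by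
      rw [div_eq_mul_inv, Complex.inv_eq_conj hnorm, mul_comm]
    rw [hinv]
    simp only [Complex.ofReal_one, one_mul, Complex.inner] at key
    rw [mul_comm (z₀ * w')] at key
    linarith
  · intro t ht
    have hmem : (t : ℂ) * z₀ ∈ ball (0 : ℂ) ‖z₀‖ := by
      simpa [abs_of_pos ht.1] using mul_lt_of_lt_one_left hr ht.2
    have := hbound _ hmem
    simp only [norm_mul, Complex.norm_real, Real.norm_eq_abs, abs_of_pos ht.1,
      mul_div_cancel_right₀ _ hr.ne'] at this
    simpa using pow_le_pow_left₀ (norm_nonneg _) this 2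

/-- A continuous function on the unit disk whose imaginary part is less than `b` in absolute value
at the origin, but not everywhere, has a point of smallest modulus where `b` is attained. -/
lemma exists_first_contact {h : ℂ → ℂ} (hc : ContinuousOn h (ball 0 1)) {b : ℝ}
    (h0 : |(h 0).im| < b) (hex : ∃ z ∈ ball (0 : ℂ) 1, b ≤ |(h z).im|) :
    ∃ z₀ ∈ ball (0 : ℂ) 1, z₀ ≠ 0 ∧ |(h z₀).im| = b ∧
      (∀ z ∈ ball (0 : ℂ) ‖z₀‖, |(h z).im| < b) ∧
      ∀ z ∈ closedBall (0 : ℂ) ‖z₀‖, |(h z).im| ≤ b := by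
  obtain ⟨z₁, hz₁, hb₁⟩ := hex
  rw [mem_ball_zero_iff] at hz₁
  have hsub : closedBall (0 : ℂ) ‖z₁‖ ⊆ ball 0 1 := closedBall_subset_ball hz₁
  have him : ContinuousOn (fun z => |(h z).im|) (ball 0 1) :=
    (Complex.continuous_im.comp_continuousOn hc).abs
  have hK : IsCompact (closedBall (0 : ℂ) ‖z₁‖ ∩ (fun z => |(h z).im|) ⁻¹' Ici b) :=
    (isCompact_closedBall _ _).of_isClosed_subset
      ((him.mono hsub).preimage_isClosed_of_isClosed isClosed_closedBall isClosed_Ici)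
      inter_subset_left
  obtain ⟨z₀, ⟨hz₀, hb₀⟩, hmin⟩ := hK.exists_isMinOn ⟨z₁, by simp, hb₁⟩ continuous_norm.continuousOn
  have hle₀ : ‖z₀‖ ≤ ‖z₁‖ := mem_closedBall_zero_iff.1 hz₀
  have hlt : ∀ z ∈ ball (0 : ℂ) ‖z₀‖, |(h z).im| < b := by
    intro z hz
    by_contra! hge
    rw [mem_ball_zero_iff] at hz
    exact absurd (hmin ⟨by simpa using hz.le.trans hle₀, hge⟩) (not_le.2 hz)
  have hne : z₀ ≠ 0 := by
    rintro rfl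
    exact absurd h0 (not_lt.2 hb₀)
  have hle : ∀ z ∈ closedBall (0 : ℂ) ‖z₀‖, |(h z).im| ≤ b := by
    intro z hz
    have hcont := (him.continuousAt (isOpen_ball.mem_nhds
      (hsub (closedBall_subset_closedBall hle₀ hz)))).continuousWithinAt (s := ball (0 : ℂ) ‖z₀‖)
    rw [← closure_ball _ (norm_ne_zero_iff.2 hne)] at hz
    have := mem_closure_iff_nhdsWithin_neBot.1 hz
    exact le_of_tendsto hcont.tendsto (eventually_mem_nhdsWithin.mono fun z hz => (hlt z hz).le)
  exact ⟨z₀, hsub hz₀, hne, le_antisymm (hle z₀ (by simp)) hb₀, hlt, hle⟩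

/-- The open door function in logarithmic coordinates, up to an additive constant. -/
noncomputable def logDoor (α k a : ℝ) (ζ : ℂ) : ℂ :=
  cexp (α * ζ) + k * (cexp ζ - a * cexp (-ζ))

lemma logDoor_hasDerivAt (α k a : ℝ) (ζ : ℂ) :
    HasDerivAt (logDoor α k a) (α * cexp (α * ζ) + k * (cexp ζ + a * cexp (-ζ))) ζ := by
  have h1 := ((hasDerivAt_id ζ).const_mul (α : ℂ)).cexp
  have h2 := (Complex.hasDerivAt_exp ζ).sub ((hasDerivAt_id ζ).neg.cexp.const_mul (a : ℂ))
  refine (h1.add (h2.const_mul (k : ℂ))).congr_deriv ?_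
  simp only [id, Pi.neg_apply]
  ring

lemma logDoor_deriv_re_pos {α k a : ℝ} (hα : 0 < α) (hα1 : α ≤ 1) (hk : 0 < k) (ha : 0 ≤ a)
    {ζ : ℂ} (hζ : |ζ.im| < π / 2) :
    0 < (α * cexp (α * ζ) + k * (cexp ζ + a * cexp (-ζ))).re := by
  rw [abs_lt] at hζ
  have hc : 0 < Real.cos ζ.im := Real.cos_pos_of_mem_Ioo ⟨by linarith, by linarith⟩
  have hc' : 0 < Real.cos (α * ζ.im) :=
    Real.cos_pos_of_mem_Ioo ⟨by nlinarith, by nlinarith⟩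
  simp only [Complex.add_re, Complex.mul_re, Complex.ofReal_re, Complex.ofReal_im, Complex.exp_re,
    Complex.neg_re, Complex.neg_im, zero_mul, sub_zero, Complex.mul_im, add_zero, Real.cos_neg]
  positivity

/-- Strict monotonicity of `logDoor` on the closed strip `|Im ζ| ≤ π / 2`. -/
lemma logDoor_strictMono {α k a : ℝ} (hα : 0 < α) (hα1 : α ≤ 1) (hk : 0 < k) (ha : 0 ≤ a)
    {ζ ζ₀ : ℂ} (hζ : |ζ.im| < π / 2) (hζ₀ : |ζ₀.im| = π / 2) :
    0 < ((starRingEnd ℂ) (ζ - ζ₀) * (logDoor α k a ζ - logDoor α k a ζ₀)).re := by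
  set d := ζ - ζ₀ with hd
  have hd0 : d ≠ 0 := by
    rw [hd, sub_ne_zero]
    rintro rfl
    exact hζ.ne hζ₀
  set D : ℂ → ℂ := fun ζ => α * cexp (α * ζ) + k * (cexp ζ + a * cexp (-ζ)) with hD
  have hder : ∀ t : ℝ, HasDerivAt
      (fun t : ℝ => ((starRingEnd ℂ) d * logDoor α k a (ζ₀ + t * d)).re)
      (‖d‖ ^ 2 * (D (ζ₀ + t * d)).re) t := by
    intro t
    have h1 : HasDerivAt (fun t : ℝ => ζ₀ + (t : ℂ) * d) (1 * d) t :=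
      ((Complex.ofRealCLM.hasDerivAt (x := t)).mul_const d).const_add ζ₀
    have h2 := ((logDoor_hasDerivAt α k a (ζ₀ + t * d)).comp t h1).const_mul ((starRingEnd ℂ) d)
    have h3 := Complex.reCLM.hasFDerivAt.comp_hasDerivAt t h2
    refine h3.congr_deriv ?_
    have : (starRingEnd ℂ) d * (D (ζ₀ + t * d) * (1 * d)) =
        ((‖d‖ ^ 2 : ℝ) : ℂ) * D (ζ₀ + t * d) := by
      push_cast
      rw [← Complex.conj_mul' d]
      ring
    rw [← Complex.re_ofReal_mul, ← this, Complex.reCLM_apply]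
  have hmono := strictMonoOn_of_deriv_pos (convex_Icc (0 : ℝ) 1)
    (fun t _ => (hder t).continuousAt.continuousWithinAt) (fun t ht => ?_)
  · have := hmono (by simp) (by simp) zero_lt_one
    simp only [Complex.ofReal_zero, zero_mul, add_zero, Complex.ofReal_one, one_mul] at this
    rw [show ζ₀ + d = ζ by simp [hd]] at this
    rw [mul_sub, Complex.sub_re]
    linarith
  · rw [interior_Icc] at ht
    rw [(hder t).deriv]
    refine mul_pos (by positivity) (logDoor_deriv_re_pos hα hα1 hk ha ?_)
    have : (ζ₀ + t * d).im = (1 - t) * ζ₀.im + t * ζ.im := by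
      simp [hd]; ring
    rw [this]
    rw [abs_lt] at hζ ⊢
    have h0 := abs_le.1 hζ₀.le
    constructor <;> nlinarith [ht.1, ht.2]

/-- Values of the open door function in logarithmic coordinates. -/
lemma exists_Rgen_eq_logDoor {c : ℂ} (hc : 0 < c.re) (α : ℝ) (n : ℕ) {z : ℂ}
    (hz : z ∈ ball (0 : ℂ) 1) :
    ∃ ζ : ℂ, |ζ.im| < π / 2 ∧ Rgen α c n z =
      logDoor α (n * α / (2 * c.re)) (‖c‖ ^ 2) ζ
        - 2 * ((n * α / (2 * c.re) : ℝ) : ℂ) * I * c.im := by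
  rw [mem_ball_zero_iff] at hz
  have h1 : 1 - z ≠ 0 := by
    rw [sub_ne_zero]
    rintro rfl
    simp at hz
  have hre : 0 < (gc c z).re := by
    have hid : gc c z =
        (((1 : ℝ) / ‖1 - z‖ ^ 2 : ℝ) : ℂ) * ((c + (starRingEnd ℂ) c * z) *
          (starRingEnd ℂ) (1 - z)) := by
      have h2 : (starRingEnd ℂ) (1 - z) ≠ 0 := (map_ne_zero _).2 h1
      push_cast
      rw [← Complex.mul_conj', gc]
      field_simp
    rw [hid, Complex.re_ofReal_mul]
    refine mul_pos (by positivity) ?_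
    have : ((c + (starRingEnd ℂ) c * z) * (starRingEnd ℂ) (1 - z)).re =
        c.re * (1 - ‖z‖ ^ 2) := by
      rw [← Complex.normSq_eq_norm_sq, Complex.normSq_apply]
      simp
      ring
    rw [this]
    have : ‖z‖ ^ 2 < 1 := by nlinarith [norm_nonneg z]
    exact mul_pos hc (by linarith)
  have hne : gc c z ≠ 0 := Complex.ne_zero_of_re_pos hre
  refine ⟨Complex.log (gc c z), ?_, ?_⟩
  · rw [Complex.log_im, Complex.abs_arg_lt_pi_div_two_iff]
    exact Or.inl hre
  · have hnum : c + (starRingEnd ℂ) c * z ≠ 0 := by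
      intro h
      exact hne (by rw [gc, h, zero_div])
    rw [Rgen, logDoor, Complex.cpow_def_of_ne_zero hne, mul_comm (Complex.log _), add_sub_assoc]
    congr 1
    rw [Complex.exp_neg, Complex.exp_log hne]
    have hcr : (c.re : ℂ) ≠ 0 := by exact_mod_cast hc.ne'
    push_cast
    rw [← Complex.mul_conj', gc]
    have hre : (c.re : ℂ) = (c + (starRingEnd ℂ) c) / 2 := by
      rw [Complex.add_conj]; push_cast; ring
    have him : I * (c.im : ℂ) = (c - (starRingEnd ℂ) c) / 2 := by
      rw [Complex.sub_conj]; push_cast; ring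
    rw [mul_assoc _ I, him]
    rw [hre] at hcr ⊢
    have hsum : c + (starRingEnd ℂ) c ≠ 0 := by
      intro h
      exact hcr (by rw [h, zero_div])
    field_simp
    ring

/-- If `|Im L|` attains its maximum over a circle at `z₀`, where it is nonzero, then `z₀ L'(z₀)` is
purely imaginary. -/
lemma mul_deriv_re_eq_zero_of_max_abs_im {L : ℂ → ℂ} {L' z₀ : ℂ} (hL : HasDerivAt L L' z₀)
    (hmax : ∀ z ∈ closedBall (0 : ℂ) ‖z₀‖, |(L z).im| ≤ |(L z₀).im|) :
    (z₀ * L').re = 0 := by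
  have h1 : HasDerivAt (fun t : ℝ => cexp (t * I) * z₀) (I * z₀) 0 := by
    have := (((Complex.ofRealCLM.hasDerivAt (x := (0 : ℝ))).mul_const I).cexp).mul_const z₀
    simpa using this
  have h2 : HasDerivAt L L' (cexp (((0 : ℝ) : ℂ) * I) * z₀) := by simpa using hL
  have h3 := Complex.imCLM.hasFDerivAt.comp_hasDerivAt (0 : ℝ) (h2.comp (0 : ℝ) h1)
  have h4 : ∀ t : ℝ, |(L (cexp (t * I) * z₀)).im| ≤ |(L z₀).im| := fun t =>
    hmax _ (by simp [Complex.norm_exp_ofReal_mul_I])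
  have h5 : Complex.imCLM (L' * (I * z₀)) = (z₀ * L').re := by
    rw [Complex.imCLM_apply, show L' * (I * z₀) = I * (z₀ * L') by ring, Complex.I_mul_im]
  rw [← h5]
  rcases le_total 0 (L z₀).im with hs | hs
  · refine IsLocalMax.hasDerivAt_eq_zero (Eventually.of_forall fun t => ?_) h3
    have := (abs_le.1 (h4 t)).2
    rw [abs_of_nonneg hs] at this
    simpa using this
  · refine IsLocalMin.hasDerivAt_eq_zero (Eventually.of_forall fun t => ?_) h3
    have := (abs_le.1 (h4 t)).1
    rw [abs_of_nonpos hs, neg_neg] at this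
    simpa using this

lemma norm_sub_sq_add_eq_norm_add_conj_sq (E c : ℂ) :
    ‖E - c‖ ^ 2 + 4 * E.re * c.re = ‖E + (starRingEnd ℂ) c‖ ^ 2 := by
  rw [← Complex.normSq_eq_norm_sq, ← Complex.normSq_eq_norm_sq, Complex.normSq_apply,
    Complex.normSq_apply]
  simp
  ring

/-- Behaviour of the logarithm of a function at a boundary point where the function first leaves
the right half-plane. -/
lemma exists_of_first_contact {L : ℂ → ℂ} {L' z₀ c : ℂ} {n : ℕ} (hc : 0 < c.re) (hn : 0 < n)
    (hz₀ : z₀ ≠ 0) (hd : DifferentiableOn ℂ L (ball 0 ‖z₀‖)) (hL : HasDerivAt L L' z₀)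
    (hL0 : L 0 = Complex.log c) (hO : (fun z => L z - L 0) =O[𝓝 0] fun z => z ^ n)
    (him : |(L z₀).im| = π / 2) (hlt : ∀ z ∈ ball (0 : ℂ) ‖z₀‖, |(L z).im| < π / 2)
    (hle : ∀ z ∈ closedBall (0 : ℂ) ‖z₀‖, |(L z).im| ≤ π / 2) :
    ∃ s μ : ℝ, cexp (L z₀) = s * I ∧ z₀ * L' = μ * I ∧
      n * (c.re ^ 2 + (s - c.im) ^ 2) ≤ 2 * c.re * (s * μ) ∧ 0 < s * (L z₀).im := by
  have hr : 0 < ‖z₀‖ := norm_pos_iff.2 hz₀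
  have hc0 : c ≠ 0 := Complex.ne_zero_of_re_pos hc
  have hre : (z₀ * L').re = 0 :=
    mul_deriv_re_eq_zero_of_max_abs_im hL (by rwa [him])
  obtain ⟨s, hs, hspos⟩ : ∃ s : ℝ, cexp (L z₀) = s * I ∧ 0 < s * (L z₀).im := by
    rcases eq_or_eq_neg_of_abs_eq him with h | h
    · refine ⟨Real.exp (L z₀).re, ?_, by rw [h]; positivity⟩
      apply Complex.ext <;> simp [Complex.exp_re, Complex.exp_im, h]
    · refine ⟨-Real.exp (L z₀).re, ?_, by rw [h, neg_mul_neg]; positivity⟩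
      apply Complex.ext <;> simp [Complex.exp_re, Complex.exp_im, h]
  have hμ : z₀ * L' = ((z₀ * L').im : ℂ) * I := by
    apply Complex.ext <;> simp [hre]
  refine ⟨s, (z₀ * L').im, hs, hμ, ?_, hspos⟩
  set μ := (z₀ * L').im
  have hden : ∀ E : ℂ, 0 ≤ E.re → E + (starRingEnd ℂ) c ≠ 0 := by
    intro E hE h
    have := congrArg Complex.re h
    simp at this
    linarith
  have hexp : ∀ z ∈ ball (0 : ℂ) ‖z₀‖, 0 < (cexp (L z)).re := by
    intro z hz
    have := abs_lt.1 (hlt z hz)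
    rw [Complex.exp_re]
    exact mul_pos (Real.exp_pos _) (Real.cos_pos_of_mem_Ioo ⟨by linarith, this.2⟩)
  have hexp₀ : (cexp (L z₀)).re = 0 := by simp [hs]
  set M : ℂ → ℂ := fun x => (cexp x - c) / (cexp x + (starRingEnd ℂ) c)
  have hM0 : M (L 0) = 0 := by simp [M, hL0, Complex.exp_log hc0]
  have hMd : ∀ x : ℂ, 0 ≤ (cexp x).re → HasDerivAt M
      ((cexp x * (cexp x + (starRingEnd ℂ) c) - (cexp x - c) * cexp x) /
        (cexp x + (starRingEnd ℂ) c) ^ 2) x := fun x hx =>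
    ((Complex.hasDerivAt_exp x).sub_const c).div ((Complex.hasDerivAt_exp x).add_const _)
      (hden _ hx)
  have h0mem : (0 : ℂ) ∈ ball 0 ‖z₀‖ := mem_ball_self hr
  have hLc : ContinuousAt L 0 := (hd.differentiableAt (isOpen_ball.mem_nhds h0mem)).continuousAt
  have hMO : (fun z => M (L z)) =O[𝓝 0] fun z => z ^ n := by
    have := ((hMd (L 0) (hexp 0 h0mem).le).differentiableAt.isBigO_sub).comp_tendsto hLc.tendsto
    simp only [Function.comp_def, hM0, sub_zero] at this
    exact this.trans hO
  have hnorm₀ : ‖M (L z₀)‖ = 1 := by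
    have := norm_sub_sq_add_eq_norm_add_conj_sq (cexp (L z₀)) c
    rw [hexp₀, mul_zero, zero_mul, add_zero] at this
    rw [norm_div, div_eq_one_iff_eq (norm_ne_zero_iff.2 (hden _ hexp₀.ge))]
    exact (sq_eq_sq₀ (norm_nonneg _) (norm_nonneg _)).1 this
  have hjack := jack_radial (w := fun z => M (L z)) hn hz₀
    (fun z hz => ((hMd (L z) (hexp z hz).le).differentiableAt.comp z
      (hd.differentiableAt (isOpen_ball.mem_nhds hz))).differentiableWithinAt)
    (fun z hz => ?_) hM0 hMO ((hMd (L z₀) hexp₀.ge).comp z₀ hL) hnorm₀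
  · have hsub : (s : ℂ) * I - c ≠ 0 := by
      intro h
      have := congrArg Complex.re h
      simp at this
      exact hc.ne' this
    have hadd : (s : ℂ) * I + (starRingEnd ℂ) c ≠ 0 := hden _ (by simp)
    have hprod : ((s : ℂ) * I + (starRingEnd ℂ) c) * (s * I - c) =
        -((c.re ^ 2 + (s - c.im) ^ 2 : ℝ) : ℂ) := by
      apply Complex.ext <;> simp [-Complex.ofReal_add, -Complex.ofReal_pow,
        -Complex.ofReal_sub] <;> ring
    have hpos : 0 < c.re ^ 2 + (s - c.im) ^ 2 := by positivity
    have hval : z₀ * ((cexp (L z₀) * (cexp (L z₀) + (starRingEnd ℂ) c) -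
        (cexp (L z₀) - c) * cexp (L z₀)) / (cexp (L z₀) + (starRingEnd ℂ) c) ^ 2 * L') / M (L z₀) =
        ((2 * c.re * (s * μ) / (c.re ^ 2 + (s - c.im) ^ 2) : ℝ) : ℂ) := by
      simp only [M, hs]
      have hsum : (starRingEnd ℂ) c + c = ((2 * c.re : ℝ) : ℂ) := by
        rw [add_comm, Complex.add_conj]
      calc _ = (s * I) * ((starRingEnd ℂ) c + c) * (z₀ * L') /
            (((s : ℂ) * I + (starRingEnd ℂ) c) * (s * I - c)) := by
              field_simp
              ring
        _ = _ := by
              rw [hprod, hsum, hμ]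
              have : ((c.re ^ 2 + (s - c.im) ^ 2 : ℝ) : ℂ) ≠ 0 := by exact_mod_cast hpos.ne'
              push_cast at this ⊢
              field_simp
              rw [Complex.I_sq]
              ring
    rw [hval, Complex.ofReal_re, le_div_iff₀ hpos] at hjack
    exact hjack
  · rw [mem_closedBall_zero_iff, norm_div]
    refine div_le_one_of_le₀ ((sq_le_sq₀ (norm_nonneg _) (norm_nonneg _)).1 ?_) (norm_nonneg _)
    rw [← norm_sub_sq_add_eq_norm_add_conj_sq]
    have := hexp z hz
    have : 0 < 4 * (cexp (L z)).re * c.re := by positivity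
    linarith

/-- The open door function omits the values taken at a first contact point. -/
lemma add_ne_Rgen_of_contact {c : ℂ} (hc : 0 < c.re) {α : ℝ} (hα : 0 < α) (hα1 : α ≤ 1) {n : ℕ}
    (hn : 0 < n) {ζ₀ : ℂ} {s μ : ℝ} (hζ₀ : |ζ₀.im| = π / 2) (hs : cexp ζ₀ = s * I)
    (hμ : n * (c.re ^ 2 + (s - c.im) ^ 2) ≤ 2 * c.re * (s * μ)) (hpos : 0 < s * ζ₀.im) {z : ℂ}
    (hz : z ∈ ball (0 : ℂ) 1) : cexp (α * ζ₀) + α * (μ * I) ≠ Rgen α c n z := by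
  intro heq
  obtain ⟨ζ, hζ, hR⟩ := exists_Rgen_eq_logDoor hc α n hz
  rw [hR] at heq
  set k : ℝ := n * α / (2 * c.re) with hk
  have hkpos : 0 < k := by positivity
  have hs0 : s ≠ 0 := left_ne_zero_of_mul hpos.ne'
  have hmono := logDoor_strictMono hα hα1 hkpos (sq_nonneg ‖c‖) hζ hζ₀
  have hT : logDoor α k (‖c‖ ^ 2) ζ - logDoor α k (‖c‖ ^ 2) ζ₀ =
      ((α * μ + 2 * k * c.im - k * (s + ‖c‖ ^ 2 / s) : ℝ) : ℂ) * I := by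
    rw [sub_eq_iff_eq_add.1 heq.symm, logDoor, Complex.exp_neg, hs, mul_inv, Complex.inv_I]
    push_cast
    ring
  set T : ℝ := α * μ + 2 * k * c.im - k * (s + ‖c‖ ^ 2 / s) with hTdef
  have hsT : 0 ≤ s * T := by
    have h1 : s * T = α / (2 * c.re) *
        (2 * c.re * (s * μ) - n * (c.re ^ 2 + (s - c.im) ^ 2)) := by
      rw [hTdef, hk, ← Complex.normSq_eq_norm_sq, Complex.normSq_apply]
      field_simp
      ring
    rw [h1]
    exact mul_nonneg (by positivity) (by linarith)
  have hprod : 0 < T * (ζ.im - ζ₀.im) := by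
    rw [hT] at hmono
    simp only [← mul_assoc, Complex.mul_re, Complex.mul_im, Complex.conj_re, Complex.conj_im,
      Complex.ofReal_re, Complex.ofReal_im, Complex.I_re, Complex.I_im, Complex.sub_im] at hmono
    linarith
  rw [← hζ₀] at hζ
  rcases lt_or_gt_of_ne hs0 with h | h
  · have him : ζ₀.im < 0 := by by_contra! h'; nlinarith
    have hTn : T ≤ 0 := by by_contra! h'; nlinarith
    rw [abs_of_neg him, abs_lt] at hζ
    nlinarith
  · have him : 0 < ζ₀.im := by by_contra! h'; nlinarith
    have hTn : 0 ≤ T := by by_contra! h'; nlinarith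
    rw [abs_of_pos him, abs_lt] at hζ
    nlinarith

/-- A holomorphic function whose derivatives of orders `1, …, n - 1` vanish at `0` differs from its
value there by `O(z ^ n)`. -/
lemma isBigO_sub_pow_of_iteratedDeriv_eq_zero {f : ℂ → ℂ} (hf : AnalyticAt ℂ f 0) {n : ℕ}
    (hk : ∀ k : ℕ, 1 ≤ k → k < n → iteratedDeriv k f 0 = 0) (hn : 0 < n) :
    (fun z => f z - f 0) =O[𝓝 0] fun z => z ^ n := by
  obtain ⟨F, hF, hev⟩ := hf.exists_eventuallyEq_sum_add_pow_mul n
  have h1 : (fun z => z ^ n * F z) =O[𝓝 0] fun z => z ^ n := by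
    simpa using (isBigO_refl (fun z : ℂ => z ^ n) (𝓝 0)).mul (hF.continuousAt.isBigO_one ℂ)
  refine h1.congr' (hev.mono fun z hz => ?_) EventuallyEq.rfl
  simp only [hz]
  rw [Finset.sum_eq_single_of_mem 0 (by simpa using hn)]
  · simp
  · intro k hkn hk0
    rw [hk k (Nat.pos_of_ne_zero hk0) (Finset.mem_range.1 hkn), smul_zero]

/-- If `q ∈ H[c^α,n]` is nonvanishing and `q + zq'/q` takes values in `R_{α,c,n}(𝔻)`,
then `|arg q| < πα/2` on `𝔻`. -/
theorem generalized_open_door (c : ℂ) (hc : 0 < c.re) (α : ℝ) (hα : 0 < α) (hα1 : α ≤ 1)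
    (n : ℕ) (hn : 0 < n)
    (q : ℂ → ℂ)
    (hqd : DifferentiableOn ℂ q (ball 0 1))
    (hq0 : q 0 = c ^ (α : ℂ))
    (hqk : ∀ k : ℕ, 1 ≤ k → k < n → iteratedDeriv k q 0 = 0)
    (hqne : ∀ z ∈ ball (0 : ℂ) 1, q z ≠ 0)
    (hmem : ∀ z ∈ ball (0 : ℂ) 1,
      q z + z * deriv q z / q z ∈ Rgen α c n '' ball 0 1) :
    ∀ z ∈ ball (0 : ℂ) 1, |(q z).arg| < π * α / 2 := by
  have hα0 : (α : ℂ) ≠ 0 := by exact_mod_cast hα.ne'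
  have hc0 : c ≠ 0 := Complex.ne_zero_of_re_pos hc
  have hball0 : (0 : ℂ) ∈ ball (0 : ℂ) 1 := mem_ball_self one_pos
  obtain ⟨h, h0, hh⟩ := exists_log_on_unit_ball hqd hqne (a := Complex.log c * α)
    (by rw [hq0, Complex.cpow_def_of_ne_zero hc0])
  set L : ℂ → ℂ := fun z => h z / α with hLdef
  have hLd : ∀ z ∈ ball (0 : ℂ) 1, HasDerivAt L (deriv q z / q z / α) z := fun z hz =>
    (hh z hz).1.div_const _
  have hqL : ∀ z ∈ ball (0 : ℂ) 1, q z = cexp (α * L z) := fun z hz => by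
    rw [(hh z hz).2, hLdef, mul_div_cancel₀ _ hα0]
  have hL0 : L 0 = Complex.log c := by
    rw [hLdef]
    simp only [h0]
    rw [mul_div_cancel_right₀ _ hα0]
  by_contra! hcon
  obtain ⟨z₁, hz₁, hz₁'⟩ := hcon
  obtain ⟨z₀, hz₀, hz₀0, him, hlt, hle⟩ := exists_first_contact (h := L) (b := π / 2)
    (fun z hz => (hLd z hz).continuousAt.continuousWithinAt)
    (by rw [hL0, Complex.log_im, Complex.abs_arg_lt_pi_div_two_iff]; exact Or.inl hc)
    ⟨z₁, hz₁, by
      by_contra! hlt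
      have him : |α * (L z₁).im| < π * α / 2 := by
        rw [abs_mul, abs_of_pos hα]
        nlinarith
      have hb := abs_lt.1 him
      have harg : (q z₁).arg = α * (L z₁).im := by
        rw [hqL z₁ hz₁, Complex.arg_exp, Complex.im_ofReal_mul]
        exact (toIocMod_eq_self _).2 ⟨by nlinarith [Real.pi_pos], by nlinarith [Real.pi_pos]⟩
      rw [harg] at hz₁'
      linarith⟩
  have hO : (fun z => L z - L 0) =O[𝓝 0] fun z => z ^ n := by
    have hexp : HasDerivAt (fun x : ℂ => cexp (α * x)) (cexp (α * L 0) * (α * 1)) (L 0) :=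
      ((hasDerivAt_id' (L 0)).const_mul (α : ℂ)).cexp
    have h1 := (hexp.isTheta_sub (mul_ne_zero (Complex.exp_ne_zero _)
      (by simpa using hα0))).isBigO_symm.comp_tendsto
      ((hLd 0 hball0).continuousAt.tendsto.prodMk (tendsto_pure.2
        (Eventually.of_forall fun _ => rfl)))
    have h2 := isBigO_sub_pow_of_iteratedDeriv_eq_zero
      (hqd.analyticAt (isOpen_ball.mem_nhds hball0)) hqk hn
    refine IsBigO.trans h1 (h2.congr' ?_ EventuallyEq.rfl)
    filter_upwards [isOpen_ball.mem_nhds hball0] with z hz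
    simp only [Function.comp_apply, hqL z hz, hqL 0 hball0]
  obtain ⟨s, μ, hs, hμ, hineq, hpos⟩ := exists_of_first_contact hc hn hz₀0
    (fun z hz => (hLd z (ball_subset_ball (mem_ball_zero_iff.1 hz₀).le hz)
      ).differentiableAt.differentiableWithinAt) (hLd z₀ hz₀) hL0 hO him hlt hle
  obtain ⟨z, hz, hRz⟩ := hmem z₀ hz₀
  refine add_ne_Rgen_of_contact hc hα hα1 hn him hs hineq hpos hz ?_
  rw [hRz, ← hqL z₀ hz₀, ← hμ]
  field_simp
end

section
/- Let c ∈ ℂ with Re c > 0 and 0 < α ≤ 1, and let Q(z) = α z g_c′(z)/g_c(z). Then for every z ∈ 𝔻 with z ≠ 0 one has z·Q′(z)/Q(z) = (1/2)[(c − c̄z)/(c + c̄z) + (1+z)/(1−z)], and consequently Re[z·Q′(z)/Q(z)] > 0; in particular Q is a starlike function on 𝔻. -/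
open Complex Metric Set

/-- `Q(z) = α z g_c'(z)/g_c(z)`. -/
noncomputable def Qfun (α : ℝ) (c : ℂ) (z : ℂ) : ℂ :=
  (α : ℂ) * z * deriv (gc c) z / gc c z

lemma Complex.re_sub_div_add_pos {a b : ℂ} (h : ‖a‖ < ‖b‖) : 0 < ((b - a) / (b + a)).re := by
  have hne : b + a ≠ 0 := by
    intro h0
    rw [eq_neg_of_add_eq_zero_left h0, norm_neg] at h
    exact lt_irrefl _ h
  have hsq : normSq a < normSq b := by
    rw [normSq_eq_norm_sq, normSq_eq_norm_sq]
    gcongr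
  rw [normSq_apply, normSq_apply] at hsq
  have hpos := normSq_pos.mpr hne
  rw [div_re, ← add_div]
  apply div_pos _ hpos
  simp only [sub_re, add_re, sub_im, add_im]
  linarith

lemma norm_conj_mul_lt {c z : ℂ} (hc : c ≠ 0) (hz : ‖z‖ < 1) :
    ‖(starRingEnd ℂ) c * z‖ < ‖c‖ := by
  rw [norm_mul, norm_conj]
  exact mul_lt_of_lt_one_right (norm_pos_iff.mpr hc) hz

lemma add_conj_mul_ne_zero {c z : ℂ} (hc : c ≠ 0) (hz : ‖z‖ < 1) :
    c + (starRingEnd ℂ) c * z ≠ 0 := by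
  intro h0
  have h := norm_conj_mul_lt hc hz
  rw [eq_neg_of_add_eq_zero_right h0, norm_neg] at h
  exact lt_irrefl _ h

lemma one_sub_ne_zero_of_norm_lt_one {z : ℂ} (hz : ‖z‖ < 1) : 1 - z ≠ 0 := by
  intro h0
  rw [← sub_eq_zero.mp h0, norm_one] at hz
  exact lt_irrefl _ hz

lemma hasDerivAt_gc (c : ℂ) {z : ℂ} (hz : 1 - z ≠ 0) :
    HasDerivAt (gc c) ((c + (starRingEnd ℂ) c) / (1 - z) ^ 2) z := by
  have h := (((hasDerivAt_id z).const_mul ((starRingEnd ℂ) c)).const_add c).div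
    ((hasDerivAt_id z).const_sub 1) hz
  exact h.congr_deriv (by simp only [id]; ring)

lemma Qfun_eq (α : ℝ) {c z : ℂ} (hc : c ≠ 0) (hz : ‖z‖ < 1) :
    Qfun α c z = α * (c + (starRingEnd ℂ) c) *
      (z / ((1 - z) * (c + (starRingEnd ℂ) c * z))) := by
  have h1 := one_sub_ne_zero_of_norm_lt_one hz
  have h2 := add_conj_mul_ne_zero hc hz
  rw [Qfun, (hasDerivAt_gc c h1).deriv, gc]
  field_simp

lemma hasDerivAt_Qfun (α : ℝ) {c z : ℂ} (hc : c ≠ 0) (hz : ‖z‖ < 1) :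
    HasDerivAt (Qfun α c) (α * (c + (starRingEnd ℂ) c) *
      ((c + (starRingEnd ℂ) c * z ^ 2) / ((1 - z) * (c + (starRingEnd ℂ) c * z)) ^ 2)) z := by
  have h1 := one_sub_ne_zero_of_norm_lt_one hz
  have h2 := add_conj_mul_ne_zero hc hz
  have h := ((hasDerivAt_id z).div (((hasDerivAt_id z).const_sub 1).mul
    (((hasDerivAt_id z).const_mul ((starRingEnd ℂ) c)).const_add c))
    (mul_ne_zero h1 h2)).const_mul (α * (c + (starRingEnd ℂ) c))
  have h' := h.congr_of_eventuallyEq (f₁ := Qfun α c) (by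
    filter_upwards [isOpen_ball.mem_nhds (mem_ball_zero_iff.mpr hz)] with w hw
    exact Qfun_eq α hc (mem_ball_zero_iff.mp hw))
  exact h'.congr_deriv (by simp only [id, Pi.mul_apply]; ring)

/-- For `z ∈ 𝔻 ∖ {0}`, `zQ'(z)/Q(z) = (1/2)[(c − c̄z)/(c + c̄z) + (1+z)/(1−z)]`,
hence `Re[zQ'(z)/Q(z)] > 0`; in particular `Q` is starlike on `𝔻`. -/
theorem Qfun_starlike (c : ℂ) (hc : 0 < c.re) (α : ℝ) (hα : 0 < α) (hα1 : α ≤ 1) :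
    (∀ z ∈ ball (0 : ℂ) 1, z ≠ 0 →
      z * deriv (Qfun α c) z / Qfun α c z =
        (1 / 2) * ((c - (starRingEnd ℂ) c * z) / (c + (starRingEnd ℂ) c * z)
          + (1 + z) / (1 - z))) ∧
    (∀ z ∈ ball (0 : ℂ) 1, z ≠ 0 →
      0 < (z * deriv (Qfun α c) z / Qfun α c z).re) ∧
    Qfun α c 0 = 0 ∧
    DifferentiableOn ℂ (Qfun α c) (ball 0 1) ∧
    Set.InjOn (Qfun α c) (ball 0 1) := by
  have hc0 : c ≠ 0 := by
    rintro rfl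
    exact lt_irrefl _ hc
  have hk : (α : ℂ) * (c + (starRingEnd ℂ) c) ≠ 0 := by
    rw [add_conj]
    exact_mod_cast (mul_pos hα (mul_pos two_pos hc)).ne'
  have hlog : ∀ z ∈ ball (0 : ℂ) 1, z ≠ 0 →
      z * deriv (Qfun α c) z / Qfun α c z =
        (1 / 2) * ((c - (starRingEnd ℂ) c * z) / (c + (starRingEnd ℂ) c * z)
          + (1 + z) / (1 - z)) := by
    intro z hz hz0
    rw [mem_ball_zero_iff] at hz
    have h1 := one_sub_ne_zero_of_norm_lt_one hz
    have h2 := add_conj_mul_ne_zero hc0 hz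
    rw [(hasDerivAt_Qfun α hc0 hz).deriv, Qfun_eq α hc0 hz]
    generalize (α : ℂ) * (c + (starRingEnd ℂ) c) = k at hk
    generalize (starRingEnd ℂ) c = d at h2 ⊢
    rw [mul_comm d z] at h2
    field_simp
    ring
  refine ⟨hlog, fun z hz hz0 => ?_, by simp [Qfun], fun z hz => ?_, fun z hz w hw h => ?_⟩
  · rw [hlog z hz hz0]
    rw [mem_ball_zero_iff] at hz
    have h1 := re_sub_div_add_pos (norm_conj_mul_lt hc0 hz)
    have h2 : 0 < ((1 + z) / (1 - z)).re := by
      simpa [← sub_eq_add_neg] using re_sub_div_add_pos (a := -z) (b := 1) (by simpa using hz)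
    rw [show (1 / 2 : ℂ) = ((1 / 2 : ℝ) : ℂ) by norm_num, re_ofReal_mul, add_re]
    linarith
  · exact (hasDerivAt_Qfun α hc0
      (mem_ball_zero_iff.mp hz)).differentiableAt.differentiableWithinAt
  · rw [mem_ball_zero_iff] at hz hw
    rw [Qfun_eq α hc0 hz, Qfun_eq α hc0 hw] at h
    have h := mul_left_cancel₀ hk h
    rw [div_eq_div_iff
      (mul_ne_zero (one_sub_ne_zero_of_norm_lt_one hz) (add_conj_mul_ne_zero hc0 hz))
      (mul_ne_zero (one_sub_ne_zero_of_norm_lt_one hw) (add_conj_mul_ne_zero hc0 hw))] at h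
    have hzw : ‖z * w‖ < 1 := by
      rw [norm_mul]
      exact mul_lt_one_of_nonneg_of_lt_one_left (norm_nonneg _) hz hw.le
    have hprod : (z - w) * (c + (starRingEnd ℂ) c * (z * w)) = 0 := by
      linear_combination h
    exact sub_eq_zero.mp ((mul_eq_zero.mp hprod).resolve_right (add_conj_mul_ne_zero hc0 hzw))
end

section
/- Let c ∈ ℂ with Re c > 0, let 0 < α ≤ 1, and let n be a positive integer. Then the open left half-plane {w ∈ ℂ : Re w < 0} is contained in the image R_{α,c,n}(𝔻). -/
open Complex Metric Set

/-- For `u` in the closed right half-plane and `|β| ≤ 1`, also `u ^ β` lies in it. -/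
lemma re_cpow_nonneg_of_re_nonneg {u : ℂ} (hu : 0 ≤ u.re) (h0 : u ≠ 0) {β : ℝ} (hβ : |β| ≤ 1) :
    0 ≤ (u ^ (β : ℂ)).re := by
  rw [cpow_def_of_ne_zero h0, exp_re, im_mul_ofReal, log_im]
  refine mul_nonneg (Real.exp_pos _).le (Real.cos_nonneg_of_mem_Icc (abs_le.1 ?_))
  have h := abs_arg_le_pi_div_two_iff.2 hu
  rw [abs_mul]
  nlinarith [abs_nonneg (arg u), abs_nonneg β]

/-- The map `R_{α,c,n}` in the half-plane coordinate `u = g_c(z)`, up to the names of the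
constants. -/
noncomputable def halfPlaneModel (α k C d : ℝ) (u : ℂ) : ℂ :=
  u ^ (α : ℂ) + k * (u - C / u) + d * I

lemma mem_slitPlane_of_re_nonneg {u : ℂ} (hu : 0 ≤ u.re) (h0 : u ≠ 0) : u ∈ slitPlane := by
  rw [mem_slitPlane_iff]
  by_contra! h
  exact h0 (Complex.ext (le_antisymm h.1 hu) h.2)

lemma differentiableAt_halfPlaneModel (α k C d : ℝ) {u : ℂ} (hu : 0 ≤ u.re) (h0 : u ≠ 0) :
    DifferentiableAt ℂ (halfPlaneModel α k C d) u := by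
  have h : DifferentiableAt ℂ (fun u : ℂ => u ^ (α : ℂ)) u :=
    differentiableAt_id.cpow_const (mem_slitPlane_of_re_nonneg hu h0)
  have h' : DifferentiableAt ℂ (fun u : ℂ => (C : ℂ) / u) u := by fun_prop (disch := exact h0)
  exact (h.add ((differentiableAt_id.sub h').const_mul _)).add_const _

lemma halfPlaneModel_re (α k C d : ℝ) (u : ℂ) :
    (halfPlaneModel α k C d u).re =
      (u ^ (α : ℂ)).re + k * (u.re - C * u.re / normSq u) := by
  simp [halfPlaneModel, div_re]

/-- Points of the closed right half-plane with bounded image are bounded. -/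
lemma norm_le_of_norm_halfPlaneModel_le {α k C d K : ℝ} (hα : 0 < α) (hα1 : α ≤ 1) (hk : 0 < k)
    (hC : 0 < C) (hK : 0 ≤ K) {u : ℂ} (hu : 0 ≤ u.re) (h0 : u ≠ 0)
    (h : ‖halfPlaneModel α k C d u‖ ≤ K) : ‖u‖ ≤ (K + |d|) / k + C + 1 := by
  have hn : 0 < ‖u‖ := norm_pos_iff.2 h0
  have hre := re_cpow_nonneg_of_re_nonneg hu h0 (β := α - 1) (abs_le.2 ⟨by linarith, by linarith⟩)
  have heq : (u ^ ((α - 1 : ℝ) : ℂ)) + k =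
      halfPlaneModel α k C d u / u + k * C / u ^ 2 - d * I / u := by
    rw [ofReal_sub, ofReal_one, cpow_sub _ _ h0, cpow_one, halfPlaneModel]
    field_simp
    ring
  have h1 : k ≤ ‖(u ^ ((α - 1 : ℝ) : ℂ)) + k‖ := by
    refine le_trans ?_ (re_le_norm _)
    simpa using hre
  have h2 : ‖(u ^ ((α - 1 : ℝ) : ℂ)) + k‖ ≤ K / ‖u‖ + k * C / ‖u‖ ^ 2 + |d| / ‖u‖ := by
    rw [heq]
    refine (norm_sub_le _ _).trans (add_le_add ((norm_add_le _ _).trans (add_le_add ?_ ?_)) ?_)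
    · rw [norm_div]; gcongr
    · simp [abs_of_pos hk, abs_of_pos hC]
    · simp
  have h3 : k * ‖u‖ ^ 2 ≤ (K + |d|) * ‖u‖ + k * C := by
    have := mul_le_mul_of_nonneg_right (h1.trans h2) (sq_nonneg ‖u‖)
    refine this.trans_eq ?_
    field_simp
    ring
  have hq : 0 ≤ (K + |d|) / k := by positivity
  have h4 : ‖u‖ ^ 2 ≤ (K + |d|) / k * ‖u‖ + C := by
    rw [← mul_le_mul_iff_right₀ hk]
    refine h3.trans_eq ?_
    field_simp
  nlinarith

/-- Bounded nonzero points with bounded image stay away from `0`. -/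
lemma le_norm_of_norm_halfPlaneModel_le {α k C d K M : ℝ} (hα : 0 < α) (hα1 : α ≤ 1) (hk : 0 < k)
    (hC : 0 < C) {u : ℂ} (h0 : u ≠ 0) (hM : 1 ≤ M) (huM : ‖u‖ ≤ M)
    (h : ‖halfPlaneModel α k C d u‖ ≤ K) : k * C / (K + M + k * M + |d|) ≤ ‖u‖ := by
  have hn : 0 < ‖u‖ := norm_pos_iff.2 h0
  have hK : 0 ≤ K := (norm_nonneg _).trans h
  have heq : k * C / u = u ^ (α : ℂ) + k * u + d * I - halfPlaneModel α k C d u := by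
    rw [halfPlaneModel]
    ring
  have h1 : ‖k * C / u‖ ≤ M + k * M + |d| + K := by
    rw [heq]
    refine (norm_sub_le _ _).trans (add_le_add ((norm_add_le _ _).trans
      (add_le_add ((norm_add_le _ _).trans (add_le_add ?_ ?_)) ?_)) h)
    · rw [norm_cpow_real]
      calc ‖u‖ ^ α ≤ M ^ α := by gcongr
        _ ≤ M ^ (1 : ℝ) := Real.rpow_le_rpow_of_exponent_le hM hα1
        _ = M := Real.rpow_one M
    · rw [norm_mul, norm_real, Real.norm_of_nonneg hk.le]; gcongr
    · simp
  rw [norm_div, norm_mul, norm_real, norm_real, Real.norm_of_nonneg hk.le,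
    Real.norm_of_nonneg hC.le, div_le_iff₀ hn] at h1
  rw [div_le_iff₀ (by positivity)]
  linarith

lemma exists_halfPlaneModel_re_neg {α k C : ℝ} (d : ℝ) (hα : 0 < α) (hk : 0 < k) (hC : 0 < C) :
    ∃ u : ℂ, 0 < u.re ∧ (halfPlaneModel α k C d u).re < 0 := by
  obtain ⟨t, ht, ht'⟩ : ∃ t : ℝ, 0 < t ∧ t < min 1 (k * C / (1 + k)) :=
    exists_between (by positivity)
  rw [lt_min_iff, lt_div_iff₀ (by positivity)] at ht'
  refine ⟨t, by simpa, ?_⟩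
  rw [halfPlaneModel_re, ← ofReal_cpow ht.le, ofReal_re, ofReal_re, normSq_ofReal]
  have h1 : t ^ α ≤ 1 := Real.rpow_le_one ht.le ht'.1.le hα.le
  have h2 : 1 + k < k * (C * t / (t * t)) := by
    rw [mul_div_mul_right _ _ ht.ne', ← mul_div_assoc, lt_div_iff₀ ht]
    linarith
  nlinarith

lemma exists_halfPlaneModel_re_nonneg {α k C : ℝ} (d : ℝ) (hC : 0 < C) :
    ∃ u : ℂ, 0 < u.re ∧ 0 ≤ (halfPlaneModel α k C d u).re := by
  have hs : 0 < √C := Real.sqrt_pos.2 hC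
  refine ⟨√C, by simpa, ?_⟩
  rw [halfPlaneModel_re, ← ofReal_cpow hs.le, ofReal_re, ofReal_re, normSq_ofReal,
    Real.mul_self_sqrt hC.le, mul_div_cancel_left₀ _ hC.ne']
  simp only [sub_self, mul_zero, add_zero]
  positivity

lemma isOpen_halfPlaneModel_image {α k C : ℝ} (d : ℝ) (hα : 0 < α) (hk : 0 < k) (hC : 0 < C) :
    IsOpen (halfPlaneModel α k C d '' {u | 0 < u.re}) := by
  have hopen : IsOpen {u : ℂ | 0 < u.re} := isOpen_lt continuous_const continuous_re
  have han : AnalyticOnNhd ℂ (halfPlaneModel α k C d) {u | 0 < u.re} := by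
    refine DifferentiableOn.analyticOnNhd (fun u (hu : 0 < u.re) => ?_) hopen
    refine (differentiableAt_halfPlaneModel α k C d hu.le ?_).differentiableWithinAt
    rintro rfl
    simp at hu
  rcases han.is_constant_or_isOpen (convex_halfSpace_re_gt 0).isPreconnected with ⟨w, hw⟩ | h
  · obtain ⟨u, hu, hneg⟩ := exists_halfPlaneModel_re_neg d hα hk hC
    obtain ⟨v, hv, hnonneg⟩ := exists_halfPlaneModel_re_nonneg (α := α) (k := k) d hC
    rw [hw u hu, ← hw v hv] at hneg
    exact absurd hnonneg hneg.not_ge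
  · exact h _ subset_rfl hopen

lemma closure_halfPlaneModel_image_inter_subset {α k C : ℝ} (d : ℝ) (hα : 0 < α) (hα1 : α ≤ 1)
    (hk : 0 < k) (hC : 0 < C) :
    closure (halfPlaneModel α k C d '' {u | 0 < u.re}) ∩ {w | w.re < 0} ⊆
      halfPlaneModel α k C d '' {u | 0 < u.re} := by
  rintro w ⟨hw, hneg : w.re < 0⟩
  set K : ℝ := ‖w‖ + 1
  have hK : 0 ≤ K := by positivity
  set M : ℝ := (K + |d|) / k + C + 1
  have hM : 1 ≤ M := by
    have : 0 ≤ (K + |d|) / k := by positivity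
    linarith
  set ε : ℝ := k * C / (K + M + k * M + |d|)
  have hε : 0 < ε := by positivity
  set T : Set ℂ := closedBall 0 M ∩ {u | 0 ≤ u.re ∧ ε ≤ ‖u‖}
  have hT0 : ∀ u ∈ T, u ≠ 0 := fun u hu => norm_pos_iff.1 (hε.trans_le hu.2.2)
  have hTc : IsCompact T := (isCompact_closedBall 0 M).inter_right
    ((isClosed_le continuous_const continuous_re).inter
      (isClosed_le continuous_const continuous_norm))
  have hcont : ContinuousOn (halfPlaneModel α k C d) T := fun u hu =>
    (differentiableAt_halfPlaneModel α k C d hu.2.1 (hT0 u hu)).continuousAt.continuousWithinAt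
  have hmem : w ∈ halfPlaneModel α k C d '' T := by
    rw [← (hTc.image_of_continuousOn hcont).isClosed.closure_eq]
    have hball : w ∈ closure (ball w 1 ∩ halfPlaneModel α k C d '' {u | 0 < u.re}) :=
      isOpen_ball.inter_closure ⟨mem_ball_self one_pos, hw⟩
    refine closure_mono ?_ hball
    rintro _ ⟨hb, u, hu : 0 < u.re, rfl⟩
    have h0 : u ≠ 0 := by
      rintro rfl
      simp at hu
    have hKu : ‖halfPlaneModel α k C d u‖ ≤ K := by
      have := norm_le_norm_add_norm_sub w (halfPlaneModel α k C d u)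
      rw [mem_ball_iff_norm'] at hb
      linarith
    have huM := norm_le_of_norm_halfPlaneModel_le hα hα1 hk hC hK hu.le h0 hKu
    exact ⟨u, ⟨by simpa using huM, hu.le,
      le_norm_of_norm_halfPlaneModel_le hα hα1 hk hC h0 hM huM hKu⟩, rfl⟩
  obtain ⟨u, hu, rfl⟩ := hmem
  refine ⟨u, hu.2.1.lt_of_ne fun h => hneg.not_ge ?_, rfl⟩
  rw [halfPlaneModel_re, ← h]
  simpa using re_cpow_nonneg_of_re_nonneg hu.2.1 (hT0 u hu) (abs_le.2 ⟨by linarith, hα1⟩)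

/-- The image of the right half-plane under `u ↦ u ^ α + k (u - C / u) + d i` contains the left
half-plane. -/
theorem left_halfPlane_subset_halfPlaneModel_image {α k C : ℝ} (d : ℝ) (hα : 0 < α) (hα1 : α ≤ 1)
    (hk : 0 < k) (hC : 0 < C) :
    {w : ℂ | w.re < 0} ⊆ halfPlaneModel α k C d '' {u | 0 < u.re} := by
  refine (convex_halfSpace_re_lt 0).isPreconnected.subset_of_closure_inter_subset
    (isOpen_halfPlaneModel_image d hα hk hC) ?_
    (closure_halfPlaneModel_image_inter_subset d hα hα1 hk hC)
  obtain ⟨u, hu, hneg⟩ := exists_halfPlaneModel_re_neg d hα hk hC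
  exact ⟨_, hneg, u, hu, rfl⟩

/-- Every point of the right half-plane is `g_c(z)` for some `z` in the disk, and there
`R_{α,c,n}` takes the value of the half-plane model. -/
lemma exists_mem_ball_Rgen_eq {c u : ℂ} (hc : 0 < c.re) (hu : 0 < u.re) (α : ℝ) (n : ℕ) :
    ∃ z ∈ ball (0 : ℂ) 1, Rgen α c n z =
      halfPlaneModel α (n * α / (2 * c.re)) (normSq c) (-(n * α * c.im / c.re)) u := by
  have hu0 : u ≠ 0 := by
    rintro rfl
    simp at hu
  set b : ℂ := (starRingEnd ℂ) c with hb
  have hub : u + b ≠ 0 := fun h => by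
    have := congrArg re h
    simp [hb] at this
    linarith
  have hr : (c.re : ℂ) ≠ 0 := ofReal_ne_zero.2 hc.ne'
  have hcb : c + b = 2 * (c.re : ℂ) := by rw [hb, add_conj]; push_cast; ring
  have hcb' : c - b = 2 * (c.im : ℂ) * I := by rw [hb, sub_conj]; push_cast; ring
  have hN : (normSq c : ℂ) = c * b := (mul_conj c).symm
  have h1 : 1 - (u - c) / (u + b) = 2 * c.re / (u + b) := by
    rw [← hcb]
    field_simp
    ring
  have h2 : c + b * ((u - c) / (u + b)) = 2 * c.re * u / (u + b) := by
    rw [← hcb]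
    field_simp
    ring
  refine ⟨(u - c) / (u + b), ?_, ?_⟩
  · rw [mem_ball_zero_iff, norm_div, div_lt_one (norm_pos_iff.2 hub),
      ← sq_lt_sq₀ (norm_nonneg _) (norm_nonneg _), ← normSq_eq_norm_sq, ← normSq_eq_norm_sq]
    simp only [normSq_apply, hb, sub_re, sub_im, add_re, add_im, conj_re, conj_im]
    nlinarith [mul_pos hc hu]
  · have hg : gc c ((u - c) / (u + b)) = u := by
      rw [gc, h1, h2]
      field_simp
    rw [Rgen, hg, h1, h2, halfPlaneModel, add_assoc]
    congr 1
    push_cast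
    have hI : (c.im : ℂ) * I = (c - b) / 2 := by rw [hcb']; ring
    have hd : -((n : ℂ) * α * c.im / c.re) * I = -((n : ℂ) * α * ((c - b) / 2) / c.re) := by
      rw [← hI]; ring
    rw [hd, hN]
    field_simp
    ring

/-- The open left half-plane is contained in `R_{α,c,n}(𝔻)`. -/
theorem left_halfPlane_subset_Rgen_image (c : ℂ) (hc : 0 < c.re)
    (α : ℝ) (hα : 0 < α) (hα1 : α ≤ 1) (n : ℕ) (hn : 0 < n) :
    {w : ℂ | w.re < 0} ⊆ Rgen α c n '' ball 0 1 := by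
  intro w hw
  have hk : 0 < n * α / (2 * c.re) := by positivity
  have hC : 0 < normSq c := normSq_pos.2 fun h => by simp [h] at hc
  obtain ⟨u, hu, rfl⟩ := left_halfPlane_subset_halfPlaneModel_image
    (-(n * α * c.im / c.re)) hα hα1 hk hC hw
  exact exists_mem_ball_Rgen_eq hc hu α n
end

section
/- Let c ∈ ℂ with Re c > 0, let 0 < α ≤ 1, and let n be a positive integer. Then the open sector {w ∈ ℂ : w ≠ 0, |arg w| < πα/2} is contained in the image R_{α,c,n}(𝔻). -/
open Complex Metric Set Real

/-- The generalized open door function in the half-plane coordinate `p = g_c(z)`, where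
`k = nα / (2 Re c)`, `D = |c|²` and `b = Im c`. -/
noncomputable def halfPlaneMap (α k D b : ℝ) (p : ℂ) : ℂ :=
  p ^ (α : ℂ) + (k * p - k * D / p - 2 * k * b * I)

/-- The sector of half-opening `θ`, for `0 < θ ≤ π / 2`, as an intersection of two half-planes. -/
def halfPlaneSector (θ : ℝ) : Set ℂ :=
  {w | w.im * Real.cos θ < w.re * Real.sin θ} ∩ {w | -(w.im * Real.cos θ) < w.re * Real.sin θ}

lemma mem_halfPlaneSector_of_abs_arg_lt {θ : ℝ} (hθ : θ ≤ π / 2) {w : ℂ} (hw : w ≠ 0)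
    (h : |w.arg| < θ) : w ∈ halfPlaneSector θ := by
  obtain ⟨h1, h2⟩ := abs_lt.1 h
  have hr : 0 < ‖w‖ := norm_pos_iff.2 hw
  have e1 : 0 < ‖w‖ * Real.sin (θ - w.arg) :=
    mul_pos hr (Real.sin_pos_of_pos_of_lt_pi (by linarith) (by linarith))
  have e2 : 0 < ‖w‖ * Real.sin (θ + w.arg) :=
    mul_pos hr (Real.sin_pos_of_pos_of_lt_pi (by linarith) (by linarith))
  rw [Real.sin_sub] at e1
  rw [Real.sin_add] at e2
  have hre := norm_mul_cos_arg w
  have him := norm_mul_sin_arg w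
  refine ⟨?_, ?_⟩ <;> simp only [mem_ofPred_eq] <;> rw [← hre, ← him] <;> nlinarith

lemma convex_halfPlaneSector (θ : ℝ) : Convex ℝ (halfPlaneSector θ) := by
  intro x hx y hy s t hs ht hst
  obtain ⟨hx1, hx2⟩ := hx
  obtain ⟨hy1, hy2⟩ := hy
  simp only [mem_ofPred_eq] at hx1 hx2 hy1 hy2
  have key : ∀ u v : ℝ, 0 < u → 0 < v → 0 < s * u + t * v := by
    intro u v hu hv
    rcases hs.eq_or_lt with h | h
    · have : t = 1 := by linarith
      simp [← h, this, hv]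
    · nlinarith [mul_pos h hu, mul_nonneg ht hv.le]
  have k1 := key _ _ (sub_pos.2 hx1) (sub_pos.2 hy1)
  have k2 := key _ _ (sub_pos.2 hx2) (sub_pos.2 hy2)
  refine ⟨?_, ?_⟩ <;>
    simp only [mem_ofPred_eq, add_re, add_im, real_smul, mul_re, mul_im, ofReal_re, ofReal_im] <;>
    nlinarith

lemma cpow_ofReal_re_nonneg {α : ℝ} (hα : 0 < α) (hα1 : α ≤ 1) {p : ℂ} (hp : 0 ≤ p.re) :
    0 ≤ (p ^ (α : ℂ)).re := by
  obtain ⟨h1, h2⟩ := abs_le.1 (abs_arg_le_pi_div_two_iff.2 hp)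
  rw [cpow_ofReal_re]
  refine mul_nonneg (by positivity) (Real.cos_nonneg_of_mem_Icc ⟨?_, ?_⟩) <;>
    nlinarith [Real.pi_pos]

lemma im_mul_cpow_ofReal_im_nonneg {α : ℝ} (hα : 0 < α) (hα1 : α ≤ 1) (p : ℂ) :
    0 ≤ p.im * (p ^ (α : ℂ)).im := by
  have h1 := neg_pi_lt_arg p
  have h2 := arg_le_pi p
  have hr : 0 ≤ ‖p‖ ^ α := by positivity
  rw [cpow_ofReal_im]
  rcases le_total 0 p.im with h | h
  · have := arg_nonneg_iff.2 h
    exact mul_nonneg h (mul_nonneg hr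
      (Real.sin_nonneg_of_nonneg_of_le_pi (by positivity) (by nlinarith)))
  · rcases h.eq_or_lt with h0 | h0
    · simp [h0]
    have := arg_neg_iff.2 h0
    exact mul_nonneg_of_nonpos_of_nonpos h (mul_nonpos_of_nonneg_of_nonpos hr
      (Real.sin_nonpos_of_nonpos_of_neg_pi_le (by nlinarith) (by nlinarith)))

lemma mul_norm_le_norm_cpow_add {α k : ℝ} (hα : 0 < α) (hα1 : α ≤ 1) (hk : 0 < k) {p : ℂ}
    (hp : 0 ≤ p.re) : k * ‖p‖ ≤ ‖p ^ (α : ℂ) + k * p‖ := by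
  have h1 := cpow_ofReal_re_nonneg hα hα1 hp
  have h2 := im_mul_cpow_ofReal_im_nonneg hα hα1 p
  apply le_of_sq_le_sq _ (norm_nonneg _)
  rw [mul_pow, ← normSq_eq_norm_sq, ← normSq_eq_norm_sq, normSq_apply, normSq_apply]
  simp only [add_re, add_im, mul_re, mul_im, ofReal_re, ofReal_im, zero_mul, sub_zero, add_zero]
  nlinarith [mul_nonneg hk.le h2, mul_nonneg hk.le (mul_nonneg hp h1),
    sq_nonneg (p ^ (α : ℂ)).re, sq_nonneg (p ^ (α : ℂ)).im]

/-- Away from `0` and `∞`, `halfPlaneMap` controls the modulus of its argument. -/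
lemma exists_norm_bounds_halfPlaneMap {α k D : ℝ} (b B : ℝ) (hα : 0 < α) (hα1 : α ≤ 1)
    (hk : 0 < k) (hD : 0 < D) (hB : 0 ≤ B) :
    ∃ r > 0, ∃ M, ∀ p : ℂ, 0 < p.re → ‖halfPlaneMap α k D b p‖ ≤ B → r ≤ ‖p‖ ∧ ‖p‖ ≤ M := by
  have hQ : 0 < B + 1 + k + 2 * k * |b| := by positivity
  refine ⟨min 1 (k * D / (B + 1 + k + 2 * k * |b|)), by positivity,
    max 1 ((B + k * D + 2 * k * |b|) / k), fun p hp hF => ?_⟩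
  have hp0 : p ≠ 0 := by rintro rfl; simp at hp
  have hn : 0 < ‖p‖ := norm_pos_iff.2 hp0
  have nb : ‖(2 * k * b * I : ℂ)‖ = 2 * k * |b| := by simp [abs_of_pos hk]
  have nD : ‖(k * D / p : ℂ)‖ = k * D / ‖p‖ := by simp [abs_of_pos hk, abs_of_pos hD]
  have nk : ‖(k * p : ℂ)‖ = k * ‖p‖ := by simp [abs_of_pos hk]
  have np : ‖p ^ (α : ℂ)‖ = ‖p‖ ^ α := norm_cpow_real p α
  constructor
  · rw [min_le_iff]
    by_contra! hlt
    obtain ⟨hlt1, hlt2⟩ := hlt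
    have e : (k * D / p : ℂ)
        = p ^ (α : ℂ) + k * p - 2 * k * b * I - halfPlaneMap α k D b p := by
      simp only [halfPlaneMap]; ring
    have h1 : k * D / ‖p‖ ≤ ‖p‖ ^ α + k * ‖p‖ + 2 * k * |b| + B := by
      rw [← nD, e, ← np, ← nk, ← nb]
      refine (norm_sub_le _ _).trans (add_le_add ((norm_sub_le _ _).trans ?_) hF)
      gcongr
      exact norm_add_le _ _
    have h2 : ‖p‖ ^ α ≤ 1 := Real.rpow_le_one hn.le hlt1.le hα.le
    rw [lt_div_iff₀ hQ] at hlt2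
    rw [div_le_iff₀ hn] at h1
    have h3 : ‖p‖ ^ α + k * ‖p‖ + 2 * k * |b| + B ≤ B + 1 + k + 2 * k * |b| := by nlinarith
    nlinarith
  · rw [le_max_iff]
    by_contra! hlt
    obtain ⟨hlt1, hlt2⟩ := hlt
    have e : p ^ (α : ℂ) + k * p = halfPlaneMap α k D b p + k * D / p + 2 * k * b * I := by
      simp only [halfPlaneMap]; ring
    have h1 : k * ‖p‖ ≤ B + k * D / ‖p‖ + 2 * k * |b| := by
      refine (mul_norm_le_norm_cpow_add hα hα1 hk hp.le).trans ?_
      rw [e, ← nD, ← nb]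
      exact (norm_add_le _ _).trans (by gcongr; exact (norm_add_le _ _).trans (by gcongr))
    have h2 : k * D / ‖p‖ ≤ k * D := div_le_self (by positivity) hlt1.le
    rw [div_lt_iff₀ hk] at hlt2
    linarith

/-- The boundary values of `halfPlaneMap` on the imaginary axis avoid the sector. -/
lemma halfPlaneMap_notMem_halfPlaneSector {α k D b : ℝ} (hα1 : α ≤ 1) (hα : 0 < α)
    (hk : 0 < k) (hbD : b ^ 2 ≤ D) {p : ℂ} (hp0 : p ≠ 0) (hp : p.re = 0) :
    halfPlaneMap α k D b p ∉ halfPlaneSector (π * α / 2) := by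
  have hpi : p = p.im * I := by apply Complex.ext <;> simp [hp]
  have hy : p.im ≠ 0 := fun h => hp0 (Complex.ext hp h)
  have hcos : 0 ≤ Real.cos (π * α / 2) :=
    Real.cos_nonneg_of_mem_Icc ⟨by nlinarith [Real.pi_pos], by nlinarith [Real.pi_pos]⟩
  have hinv : (k * D / p : ℂ) = ((-(k * D / p.im) : ℝ) : ℂ) * I := by
    have : (p.im : ℂ) ≠ 0 := by exact_mod_cast hy
    rw [hpi]
    simp only [mul_im, ofReal_re, I_im, ofReal_im, I_re, mul_one, mul_zero, add_zero]
    push_cast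
    field_simp
    simp
  have hre : (halfPlaneMap α k D b p).re = (p ^ (α : ℂ)).re := by
    simp only [halfPlaneMap]
    rw [hinv]
    simp [hp]
  have him : (halfPlaneMap α k D b p).im
      = (p ^ (α : ℂ)).im + k * (p.im + D / p.im - 2 * b) := by
    simp only [halfPlaneMap]
    rw [hinv]
    simp
    ring
  rintro ⟨h1, h2⟩
  simp only [mem_ofPred_eq, hre, him, cpow_ofReal_re, cpow_ofReal_im] at h1 h2
  rcases hy.lt_or_gt with h | h
  · have harg : p.arg = -(π / 2) := arg_eq_neg_pi_div_two_iff.2 ⟨hp, h⟩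
    have e : -(π / 2) * α = -(π * α / 2) := by ring
    rw [harg, e, Real.sin_neg, Real.cos_neg] at h2
    have hs : p.im + D / p.im - 2 * b ≤ 0 := by
      have : p.im + D / p.im - 2 * b = (p.im ^ 2 + D - 2 * b * p.im) / p.im := by
        field_simp
      rw [this]
      exact div_nonpos_of_nonneg_of_nonpos (by nlinarith [sq_nonneg (p.im - b)]) h.le
    have := mul_nonneg hcos (mul_nonneg hk.le (neg_nonneg.2 hs))
    nlinarith
  · have harg : p.arg = π / 2 := arg_eq_pi_div_two_iff.2 ⟨hp, h⟩
    have e : π / 2 * α = π * α / 2 := by ring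
    rw [harg, e] at h1
    have hs : 0 ≤ p.im + D / p.im - 2 * b := by
      have : p.im + D / p.im - 2 * b = (p.im ^ 2 + D - 2 * b * p.im) / p.im := by
        field_simp
      rw [this]
      exact div_nonneg (by nlinarith [sq_nonneg (p.im - b)]) h.le
    have := mul_nonneg hcos (mul_nonneg hk.le hs)
    nlinarith

lemma differentiableOn_halfPlaneMap (α k D b : ℝ) :
    DifferentiableOn ℂ (halfPlaneMap α k D b) slitPlane := by
  intro p hp
  have hp0 := slitPlane_ne_zero hp
  unfold halfPlaneMap
  refine DifferentiableAt.differentiableWithinAt ?_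
  refine (differentiableAt_id.cpow_const hp).add ?_
  exact ((differentiableAt_id.const_mul _).sub
    ((differentiableAt_const _).div differentiableAt_id hp0)).sub_const _

lemma halfPlaneMap_ofReal {α k D b t : ℝ} (ht : 0 < t) :
    halfPlaneMap α k D b t
      = ((t ^ α + k * t - k * D / t : ℝ) : ℂ) + ((-(2 * k * b) : ℝ) : ℂ) * I := by
  simp only [halfPlaneMap]
  rw [← ofReal_cpow ht.le]
  push_cast
  ring

lemma halfPlaneMap_ofReal_re {α k D b t : ℝ} (ht : 0 < t) :
    (halfPlaneMap α k D b t).re = t ^ α + k * t - k * D / t := by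
  rw [halfPlaneMap_ofReal ht]
  simp

lemma halfPlaneMap_ofReal_im {α k D b t : ℝ} (ht : 0 < t) :
    (halfPlaneMap α k D b t).im = -(2 * k * b) := by
  rw [halfPlaneMap_ofReal ht]
  simp

lemma isOpen_image_halfPlaneMap {α k D : ℝ} (b : ℝ) (hα : 0 < α) (hk : 0 < k) (hD : 0 < D) :
    IsOpen (halfPlaneMap α k D b '' {p | 0 < p.re}) := by
  have hopen : IsOpen {p : ℂ | 0 < p.re} := isOpen_lt continuous_const continuous_re
  have hsub : {p : ℂ | 0 < p.re} ⊆ slitPlane := fun p hp => Or.inl hp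
  have han := ((differentiableOn_halfPlaneMap α k D b).mono hsub).analyticOnNhd hopen
  rcases han.is_constant_or_isOpen (convex_halfSpace_re_gt 0).isPreconnected with h | h
  · obtain ⟨w, hw⟩ := h
    have h1 := hw ((1 : ℝ) : ℂ) (by simp)
    have h2 := hw ((2 : ℝ) : ℂ) (by simp)
    have h3 := congrArg re (h1.trans h2.symm)
    rw [halfPlaneMap_ofReal_re one_pos, halfPlaneMap_ofReal_re two_pos, Real.one_rpow] at h3
    have := Real.one_le_rpow (x := 2) (by norm_num) hα.le
    nlinarith [mul_pos hk hD]
  · exact h _ subset_rfl hopen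

lemma halfPlaneSector_subset_image_halfPlaneMap {α k D b : ℝ} (hα : 0 < α) (hα1 : α ≤ 1)
    (hk : 0 < k) (hD : 0 < D) (hbD : b ^ 2 ≤ D) :
    halfPlaneSector (π * α / 2) ⊆ halfPlaneMap α k D b '' {p | 0 < p.re} := by
  refine (convex_halfPlaneSector _).isPreconnected.subset_of_closure_inter_subset
    (isOpen_image_halfPlaneMap b hα hk hD) ?_ ?_
  · have hpi := Real.pi_pos
    have hsin : 0 < Real.sin (π * α / 2) :=
      Real.sin_pos_of_pos_of_lt_pi (by positivity) (by nlinarith)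
    have hcos : 0 ≤ Real.cos (π * α / 2) :=
      Real.cos_nonneg_of_mem_Icc ⟨by nlinarith, by nlinarith⟩
    set s := Real.sin (π * α / 2)
    set u := Real.cos (π * α / 2)
    have hq : 0 < √D := Real.sqrt_pos.2 hD
    have hqq : √D * √D = D := Real.mul_self_sqrt hD.le
    set t := √D + 2 * |b| * u / s with ht
    have htq : √D ≤ t := le_add_of_nonneg_right (by positivity)
    have ht0 : 0 < t := hq.trans_le htq
    have hDt : k * D / t ≤ k * √D := by
      rw [div_le_iff₀ ht0, mul_assoc]
      gcongr
      exact hqq.symm.le.trans (by gcongr)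
    have hts : (t - √D) * s = 2 * |b| * u := by
      rw [ht, add_sub_cancel_left, div_mul_cancel₀ _ hsin.ne']
    have hta : 0 < t ^ α := by positivity
    have hlow : 2 * k * |b| * u < (t ^ α + k * t - k * D / t) * s := by
      have : 2 * k * |b| * u = (k * t - k * √D) * s := by
        rw [← mul_sub, mul_assoc k, hts]; ring
      rw [this]
      exact mul_lt_mul_of_pos_right (by linarith) hsin
    have hb1 : k * b * u ≤ k * |b| * u := by gcongr; exact le_abs_self b
    have hb2 : -(k * b * u) ≤ k * |b| * u := by
      rw [← neg_mul, ← mul_neg]; gcongr; exact neg_le_abs b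
    refine ⟨halfPlaneMap α k D b t, ⟨?_, ?_⟩, t, by simpa using ht0, rfl⟩ <;>
      simp only [mem_ofPred_eq, halfPlaneMap_ofReal_re ht0, halfPlaneMap_ofReal_im ht0] <;>
      linarith
  · rintro w ⟨hw, hwS⟩
    obtain ⟨r, hr, M, hrM⟩ := exists_norm_bounds_halfPlaneMap b (‖w‖ + 1) hα hα1 hk hD
      (by positivity)
    let K : Set ℂ := closedBall 0 M ∩ ({p | 0 ≤ p.re} ∩ {p | r ≤ ‖p‖})
    have hK : IsCompact K := (isCompact_closedBall 0 M).inter_right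
      ((isClosed_le continuous_const continuous_re).inter
        (isClosed_le continuous_const continuous_norm))
    have hne : ∀ p ∈ K, p ≠ 0 := by
      rintro p ⟨-, -, hp⟩ rfl
      simp only [mem_ofPred_eq, norm_zero] at hp
      linarith
    have hslit : K ⊆ slitPlane := by
      intro p hp
      have hre : 0 ≤ p.re := hp.2.1
      rcases hre.eq_or_lt with h | h
      · exact Or.inr fun him => hne p hp (Complex.ext h.symm him)
      · exact Or.inl h
    have hFK := hK.image_of_continuousOn
      ((differentiableOn_halfPlaneMap α k D b).continuousOn.mono hslit)
    have hwK : w ∈ halfPlaneMap α k D b '' K := by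
      rw [← hFK.isClosed.closure_eq]
      rw [Metric.mem_closure_iff] at hw ⊢
      intro ε hε
      obtain ⟨v, ⟨p, hp, rfl⟩, hv⟩ := hw (min ε 1) (by positivity)
      refine ⟨_, ⟨p, ?_, rfl⟩, hv.trans_le (min_le_left _ _)⟩
      have hv1 := hv.trans_le (min_le_right _ _)
      rw [dist_comm, dist_eq_norm] at hv1
      have := norm_le_norm_add_norm_sub' (halfPlaneMap α k D b p) w
      obtain ⟨h1, h2⟩ := hrM p hp (by linarith)
      exact ⟨by simpa using h2, le_of_lt (show 0 < p.re from hp), h1⟩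
    obtain ⟨p, hp, rfl⟩ := hwK
    have hre : 0 ≤ p.re := hp.2.1
    rcases hre.eq_or_lt with h | h
    · exact absurd hwS
        (halfPlaneMap_notMem_halfPlaneSector hα1 hα hk hbD (hne p hp) h.symm)
    · exact ⟨p, h, rfl⟩

/-- `g_c` maps the unit disk onto the right half-plane. -/
lemma exists_gc_eq {c p : ℂ} (hc : 0 < c.re) (hp : 0 < p.re) :
    ∃ z ∈ ball (0 : ℂ) 1, gc c z = p ∧ z = (p - c) / (p + (starRingEnd ℂ) c) := by
  have hd : p + (starRingEnd ℂ) c ≠ 0 := by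
    intro h
    have := congrArg re h
    simp at this
    linarith
  refine ⟨_, ?_, ?_, rfl⟩
  · rw [mem_ball_zero_iff, norm_div, div_lt_one (norm_pos_iff.2 hd)]
    apply lt_of_pow_lt_pow_left₀ 2 (norm_nonneg _)
    rw [← normSq_eq_norm_sq, ← normSq_eq_norm_sq, normSq_apply, normSq_apply]
    simp only [sub_re, sub_im, add_re, add_im, conj_re, conj_im]
    nlinarith [mul_pos hc hp]
  · have hcc : c + (starRingEnd ℂ) c ≠ 0 := by
      intro h
      have := congrArg re h
      simp at this
      linarith
    have e1 : 1 - (p - c) / (p + (starRingEnd ℂ) c)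
        = (c + (starRingEnd ℂ) c) / (p + (starRingEnd ℂ) c) := by
      field_simp; ring
    have e2 : c + (starRingEnd ℂ) c * ((p - c) / (p + (starRingEnd ℂ) c))
        = p * (c + (starRingEnd ℂ) c) / (p + (starRingEnd ℂ) c) := by
      field_simp; ring
    rw [gc, e1, e2]
    field_simp

lemma exists_Rgen_eq_halfPlaneMap {c p : ℂ} (hc : 0 < c.re) (hp : 0 < p.re) (α : ℝ) (n : ℕ) :
    ∃ z ∈ ball (0 : ℂ) 1,
      Rgen α c n z = halfPlaneMap α (n * α / (2 * c.re)) (normSq c) c.im p := by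
  obtain ⟨z, hz, hg, hzp⟩ := exists_gc_eq hc hp
  refine ⟨z, hz, ?_⟩
  have hp0 : p ≠ 0 := by rintro rfl; simp at hp
  have hd : p + (starRingEnd ℂ) c ≠ 0 := by
    intro h
    have := congrArg re h
    simp at this
    linarith
  have hcr : (c.re : ℂ) ≠ 0 := by exact_mod_cast hc.ne'
  have hcc : c + (starRingEnd ℂ) c = 2 * c.re := by rw [add_conj]; push_cast; ring
  have hci : 2 * (c.im : ℂ) * I = c - (starRingEnd ℂ) c := by rw [sub_conj]; push_cast; ring
  have e1 : 1 - z = 2 * c.re / (p + (starRingEnd ℂ) c) := by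
    rw [hzp, ← hcc]; field_simp; ring
  have e2 : c + (starRingEnd ℂ) c * z = p * (2 * c.re) / (p + (starRingEnd ℂ) c) := by
    rw [hzp, ← hcc]; field_simp; ring
  have e3 : (2 * ((n * α / (2 * c.re) : ℝ) : ℂ) * c.im * I : ℂ)
      = ((n * α / (2 * c.re) : ℝ) : ℂ) * (c - (starRingEnd ℂ) c) := by
    rw [← hci]; ring
  rw [Rgen, halfPlaneMap, hg, e1, e2, e3, hzp, normSq_eq_conj_mul_self]
  congr 1
  push_cast
  field_simp
  ring

/-- The open sector `|arg w| < πα/2` is contained in `R_{α,c,n}(𝔻)`. -/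
theorem sector_subset_Rgen_image (c : ℂ) (hc : 0 < c.re)
    (α : ℝ) (hα : 0 < α) (hα1 : α ≤ 1) (n : ℕ) (hn : 0 < n) :
    {w : ℂ | w ≠ 0 ∧ |w.arg| < π * α / 2} ⊆ Rgen α c n '' ball 0 1 := by
  rintro w ⟨hw0, hw⟩
  have hc0 : c ≠ 0 := by rintro rfl; simp at hc
  have hθ : π * α / 2 ≤ π / 2 := by nlinarith [Real.pi_pos]
  obtain ⟨p, hp, rfl⟩ := halfPlaneSector_subset_image_halfPlaneMap (D := normSq c)
    (b := c.im) (k := n * α / (2 * c.re)) hα hα1 (by positivity) (normSq_pos.2 hc0)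
    (by rw [normSq_apply]; nlinarith [sq_nonneg c.re])
    (mem_halfPlaneSector_of_abs_arg_lt hθ hw0 hw)
  obtain ⟨z, hz, hzR⟩ := exists_Rgen_eq_halfPlaneMap hc hp α n
  exact ⟨z, hz, hzR⟩
end

section
/- Let 0 < α < 1. If a function q ∈ H[1,1] satisfies, for all z ∈ 𝔻, q(z) ≠ 0, q(z) + z·q′(z)/q(z) ≠ 0, and |arg(q(z) + z·q′(z)/q(z))| < πα/2 + arctan[ α cos(πα/2) / ((1−α)^{(1−α)/2}(1+α)^{(1+α)/2} + α sin(πα/2)) ], then |arg q(z)| < πα/2 for all z ∈ 𝔻. -/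
open Complex Metric Set Real

/-- A holomorphic function without zeros on a disk about the origin, equal to `1` at the origin,
has a holomorphic logarithm vanishing at the origin. -/
theorem exists_hasDerivAt_log_of_ne_zero {q : ℂ → ℂ} {r : ℝ}
    (hr : 0 < r) (hqd : DifferentiableOn ℂ q (ball 0 r)) (hq0 : q 0 = 1)
    (hqne : ∀ z ∈ ball (0 : ℂ) r, q z ≠ 0) :
    ∃ L : ℂ → ℂ, L 0 = 0 ∧ ∀ z ∈ ball (0 : ℂ) r,
      HasDerivAt L (deriv q z / q z) z ∧ cexp (L z) = q z := by
  obtain ⟨L, hL⟩ := ((hqd.deriv isOpen_ball).div hqd hqne).isExactOn_ball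
  have h0 : (0 : ℂ) ∈ ball (0 : ℂ) r := mem_ball_self hr
  refine ⟨fun z => L z - L 0, sub_self _, fun z hz => ⟨(hL z hz).sub_const _, ?_⟩⟩
  have hconst : ∀ y ∈ ball (0 : ℂ) r,
      HasDerivAt (fun z => cexp (-(L z - L 0)) * q z) 0 y := fun y hy => by
    have hq := (hqd.differentiableAt (isOpen_ball.mem_nhds hy)).hasDerivAt
    convert! (((hL y hy).sub_const (L 0)).neg.cexp).mul hq using 1
    have := hqne y hy
    simp only [Pi.div_apply]
    field_simp
    ring
  have key := isOpen_ball.is_const_of_deriv_eq_zero (convex_ball (0 : ℂ) r).isPreconnected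
    (fun y hy => (hconst y hy).differentiableAt.differentiableWithinAt)
    (fun y hy => (hconst y hy).deriv) hz h0
  simp only [sub_self, neg_zero, Complex.exp_zero, hq0, mul_one] at key
  rw [Complex.exp_neg, inv_mul_eq_one₀ (Complex.exp_ne_zero _)] at key
  exact key

/-- If a function is nonnegative on `[0, 1)` and vanishes at `1`, its derivative at `1` is
nonpositive. -/
theorem HasDerivAt.nonpos_of_nonneg_of_eq_zero {f : ℝ → ℝ} {f' : ℝ}
    (hf : HasDerivAt f f' 1) (hf0 : ∀ t, 0 ≤ t → t < 1 → 0 ≤ f t) (hf1 : f 1 = 0) : f' ≤ 0 := by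
  have h := hf.hasDerivWithinAt (s := Iio 1)
  rw [hasDerivWithinAt_iff_tendsto_slope' (by simp)] at h
  refine le_of_tendsto h ?_
  filter_upwards [Ioo_mem_nhdsLT (show (0 : ℝ) < 1 by norm_num)] with t ht
  rw [slope_def_field, hf1, sub_zero]
  exact div_nonpos_of_nonneg_of_nonpos (hf0 t ht.1.le ht.2) (by linarith [ht.2])

/-- The Schwarz lemma for holomorphic functions with positive real part. -/
theorem norm_sub_one_mul_le_of_re_pos {p : ℂ → ℂ} {r : ℝ} (hp : DifferentiableOn ℂ p (ball 0 r))
    (hp0 : p 0 = 1) (hre : ∀ z ∈ ball (0 : ℂ) r, 0 < (p z).re) {z : ℂ} (hz : z ∈ ball (0 : ℂ) r) :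
    r * ‖p z - 1‖ ≤ ‖z‖ * ‖p z + 1‖ := by
  have hne : ∀ z ∈ ball (0 : ℂ) r, p z + 1 ≠ 0 := fun z hz h => by
    have := congrArg Complex.re h
    simp at this
    linarith [hre z hz]
  have hr : 0 < r := nonempty_ball.1 ⟨z, hz⟩
  have hd : DifferentiableOn ℂ (fun z => (p z - 1) / (p z + 1)) (ball 0 r) :=
    (hp.sub_const 1).div (hp.add_const 1) hne
  have hle : ∀ z ∈ ball (0 : ℂ) r, ‖(p z - 1) / (p z + 1)‖ ≤ 1 := fun z hz => by
    rw [norm_div]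
    refine div_le_one_of_le₀ ?_ (norm_nonneg _)
    rw [← sq_le_sq₀ (norm_nonneg _) (norm_nonneg _), Complex.sq_norm, Complex.sq_norm,
      normSq_apply, normSq_apply]
    simp
    nlinarith [hre z hz]
  have := Complex.dist_le_div_mul_dist_of_mapsTo_ball (R₂ := 1) hd
    (fun z hz => by simpa [hp0] using hle z hz) hz
  have hpos : 0 < ‖p z + 1‖ := norm_pos_iff.2 (hne z hz)
  simp only [hp0, sub_self, zero_div, dist_zero_right, norm_div] at this
  rw [div_le_iff₀ hpos, div_mul_eq_mul_div, div_mul_eq_mul_div, le_div_iff₀ hr] at this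
  linarith

/-- A form of Jack's lemma for functions with positive real part: where such a function first
reaches the imaginary axis, `z * p' z` is real and at most `-(1 + |p z| ^ 2) / 2`. -/
theorem mul_deriv_of_re_eq_zero {p : ℂ → ℂ} {z₀ p' : ℂ} (hp : DifferentiableOn ℂ p (ball 0 ‖z₀‖))
    (hp0 : p 0 = 1) (hre : ∀ z ∈ ball (0 : ℂ) ‖z₀‖, 0 < (p z).re)
    (hre' : ∀ z, ‖z‖ = ‖z₀‖ → 0 ≤ (p z).re) (hz₀ : (p z₀).re = 0)
    (hd : HasDerivAt p p' z₀) :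
    (z₀ * p').im = 0 ∧ (z₀ * p').re ≤ -(1 + (p z₀).im ^ 2) / 2 := by
  have hne : z₀ ≠ 0 := by
    rintro rfl
    simp [hp0] at hz₀
  have hpos : 0 < ‖z₀‖ := norm_pos_iff.2 hne
  constructor
  · have hg : HasDerivAt (fun θ : ℂ => p (z₀ * cexp (θ * I))) (p' * (z₀ * I)) (0 : ℝ) := by
      refine HasDerivAt.comp (h₂ := p) (0 : ℂ) (by simpa using hd) ?_
      simpa using (((hasDerivAt_id (0 : ℂ)).mul_const I).cexp).const_mul z₀
    have h := hg.real_of_complex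
    have hmin : IsLocalMin (fun θ : ℝ => (p (z₀ * cexp (θ * I))).re) 0 :=
      Filter.Eventually.of_forall fun θ => by
        simpa [hz₀] using hre' (z₀ * cexp (θ * I)) (by simp [Complex.norm_exp_ofReal_mul_I])
    have := hmin.hasDerivAt_eq_zero h
    simp at this ⊢
    linarith
  · have hg : HasDerivAt (fun t : ℂ => p (t * z₀)) (p' * z₀) (1 : ℝ) := by
      refine HasDerivAt.comp (h₂ := p) (1 : ℂ) (by simpa using hd) ?_
      simpa using (hasDerivAt_id (1 : ℂ)).mul_const z₀
    have hx := hg.real_of_complex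
    have hy := (hg.const_mul (-I)).real_of_complex
    have hf := (((hasDerivAt_id (1 : ℝ)).pow 2).mul
      (((hx.add_const 1).pow 2).add (hy.pow 2))).sub (((hx.sub_const 1).pow 2).add (hy.pow 2))
    have h := hf.nonpos_of_nonneg_of_eq_zero (fun t ht0 ht1 => ?_) ?_
    · simp [hz₀] at h ⊢
      linarith
    · have hmem : (t : ℂ) * z₀ ∈ ball (0 : ℂ) ‖z₀‖ := by
        simp [abs_of_nonneg ht0]
        nlinarith
      have hs := norm_sub_one_mul_le_of_re_pos hp hp0 hre hmem
      have hs' : ‖p (t * z₀) - 1‖ ≤ t * ‖p (t * z₀) + 1‖ := by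
        rw [norm_mul, Complex.norm_real, Real.norm_of_nonneg ht0] at hs
        refine le_of_mul_le_mul_left ?_ hpos
        linarith
      rw [← sq_le_sq₀ (norm_nonneg _) (by positivity), mul_pow, Complex.sq_norm, Complex.sq_norm,
        normSq_apply, normSq_apply] at hs'
      simp at hs' ⊢
      linarith
    · simp [hz₀]

/-- The weighted AM-GM inequality behind the optimal constant. -/
theorem exp_le_mul_cosh {α : ℝ} (hα0 : -1 < α) (hα1 : α < 1) (x : ℝ) :
    Real.exp (α * x) ≤
      (1 - α) ^ ((1 - α) / 2) * (1 + α) ^ ((1 + α) / 2) * Real.cosh x := by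
  have h1 : 0 < 1 - α := by linarith
  have h2 : 0 < 1 + α := by linarith
  have h := Real.geom_mean_le_arith_mean2_weighted (w₁ := (1 - α) / 2) (w₂ := (1 + α) / 2)
    (p₁ := Real.exp (-x) / (1 - α)) (p₂ := Real.exp x / (1 + α)) (by positivity) (by positivity)
    (by positivity) (by positivity) (by ring)
  rw [Real.div_rpow (by positivity) h1.le, Real.div_rpow (by positivity) h2.le,
    ← Real.exp_mul, ← Real.exp_mul, div_mul_div_comm, ← Real.exp_add,
    div_le_iff₀ (by positivity)] at h
  have e1 : -x * ((1 - α) / 2) + x * ((1 + α) / 2) = α * x := by ring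
  have e2 : (1 - α) / 2 * (Real.exp (-x) / (1 - α)) + (1 + α) / 2 * (Real.exp x / (1 + α))
      = Real.cosh x := by
    rw [Real.cosh_eq]
    field_simp
    ring
  rw [e1, e2] at h
  linarith

/-- The argument of `exp (α x + iθ) + iαk` with `θ = πα/2`, `cosh x ≤ k`, is at least the bound in
Mocanu's theorem. -/
theorem le_arg_exp_add_mul_I {α x k : ℝ} (hα0 : 0 < α) (hα1 : α < 1) (hk : Real.cosh x ≤ k) :
    π * α / 2 + Real.arctan (α * Real.cos (π * α / 2) /
          ((1 - α) ^ ((1 - α) / 2) * (1 + α) ^ ((1 + α) / 2)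
            + α * Real.sin (π * α / 2))) ≤
      (cexp ((α * x : ℝ) + (π * α / 2 : ℝ) * I) + (α * k : ℝ) * I).arg := by
  have hM := exp_le_mul_cosh (by linarith) hα1 x
  set M := (1 - α) ^ ((1 - α) / 2) * (1 + α) ^ ((1 + α) / 2) with hMdef
  have hMpos : 0 < M := by
    have : 0 < 1 - α := by linarith
    positivity
  set θ := π * α / 2 with hθ
  have hθ0 : 0 < θ := by positivity
  have hθ1 : θ < π / 2 := by
    rw [hθ]
    nlinarith [Real.pi_pos]
  have hs : 0 < Real.sin θ := Real.sin_pos_of_pos_of_lt_pi hθ0 (by linarith [Real.pi_pos])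
  have hc : 0 < Real.cos θ := Real.cos_pos_of_mem_Ioo ⟨by linarith, hθ1⟩
  have hk0 : 0 < k := (Real.cosh_pos x).trans_le hk
  set A := Real.exp (α * x) with hA
  have hA0 : 0 < A := Real.exp_pos _
  set u := A + α * k * Real.sin θ with hu
  set v := α * k * Real.cos θ with hv
  have hu0 : 0 < u := by positivity
  set φ := Real.arctan (v / u) with hφ
  have hφ1 : φ < π / 2 := Real.arctan_lt_pi_div_two _
  have hφ0 : 0 < φ := Real.arctan_pos.2 (by positivity)
  have hcφ : 0 < Real.cos φ := Real.cos_arctan_pos _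
  have htan : Real.sin φ * u = v * Real.cos φ := by
    have := Real.tan_arctan (v / u)
    rw [← hφ, Real.tan_eq_sin_div_cos, div_eq_div_iff hcφ.ne' hu0.ne'] at this
    exact this
  have harg : (cexp ((α * x : ℝ) + θ * I) + (α * k : ℝ) * I).arg = θ + φ := by
    have : cexp ((α * x : ℝ) + θ * I) + (α * k : ℝ) * I =
        ((u / Real.cos φ : ℝ) : ℂ) *
          (Complex.cos ((θ + φ : ℝ) : ℂ) + Complex.sin ((θ + φ : ℝ) : ℂ) * I) := by
      have hsc := Real.sin_sq_add_cos_sq θ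
      apply Complex.ext
      · simp [Complex.exp_re, Complex.cos_ofReal_re, Complex.cos_ofReal_im,
          Complex.sin_ofReal_im, Complex.sin_ofReal_re, -ofReal_add, -ofReal_mul, -ofReal_div]
        rw [← hA, Real.cos_add, div_mul_eq_mul_div, eq_div_iff hcφ.ne']
        linear_combination Real.sin θ * htan + Real.cos φ * Real.cos θ * hu
      · simp [Complex.exp_im, Complex.cos_ofReal_re, Complex.cos_ofReal_im,
          Complex.sin_ofReal_im, Complex.sin_ofReal_re, -ofReal_add, -ofReal_mul, -ofReal_div]
        rw [← hA, Real.sin_add, div_mul_eq_mul_div, eq_div_iff hcφ.ne']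
        linear_combination (-Real.cos θ) * htan - α * k * Real.cos φ * hsc
    rw [this, Complex.arg_mul_cos_add_sin_mul_I (by positivity) ⟨by linarith, by linarith⟩]
  rw [harg]
  gcongr
  rw [hφ]
  apply Real.arctan_mono
  rw [div_le_div_iff₀ (by positivity) hu0]
  have h1 : A ≤ M * k := hM.trans (by gcongr)
  nlinarith [mul_le_mul_of_nonneg_left h1 (mul_pos hα0 hc).le]

/-- A continuous real function on the unit disk which vanishes at the origin, and reaches `c > 0`
in absolute value, reaches it first at some point. -/
theorem exists_first_abs_eq {f : ℂ → ℝ} {c : ℝ} (hf : ContinuousOn f (ball 0 1)) (h0 : f 0 = 0)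
    (hc : 0 < c) {z₁ : ℂ} (hz₁ : z₁ ∈ ball (0 : ℂ) 1) (h1 : c ≤ |f z₁|) :
    ∃ z₀ ∈ ball (0 : ℂ) 1, |f z₀| = c ∧ (∀ z ∈ ball (0 : ℂ) ‖z₀‖, |f z| < c) ∧
      ∀ z, ‖z‖ = ‖z₀‖ → |f z| ≤ c := by
  have hsub : closedBall (0 : ℂ) ‖z₁‖ ⊆ ball 0 1 :=
    closedBall_subset_ball (by simpa using hz₁)
  have hcont : ContinuousOn (fun z => |f z|) (closedBall (0 : ℂ) ‖z₁‖) := (hf.mono hsub).abs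
  have hcomp : IsCompact (closedBall (0 : ℂ) ‖z₁‖ ∩ (fun z => |f z|) ⁻¹' Ici c) :=
    (isCompact_closedBall (0 : ℂ) ‖z₁‖).of_isClosed_subset
      (hcont.preimage_isClosed_of_isClosed isClosed_closedBall isClosed_Ici) inter_subset_left
  obtain ⟨z₀, ⟨hz₀, hcz₀⟩, hmin⟩ := hcomp.exists_isMinOn ⟨z₁, by simpa using h1⟩
    continuous_norm.continuousOn
  have hz₀' : ‖z₀‖ ≤ ‖z₁‖ := by simpa using hz₀
  have hlt : ∀ z ∈ ball (0 : ℂ) ‖z₀‖, |f z| < c := fun z hz => by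
    by_contra! h
    have hz : ‖z‖ < ‖z₀‖ := by simpa using hz
    have : ‖z₀‖ ≤ ‖z‖ := hmin ⟨by simpa using hz.le.trans hz₀', h⟩
    linarith
  have hne : ‖z₀‖ ≠ 0 := by
    intro h
    rw [norm_eq_zero.1 h] at hcz₀
    simp only [mem_preimage, h0, abs_zero, mem_Ici] at hcz₀
    linarith
  have hle : ∀ z, ‖z‖ = ‖z₀‖ → |f z| ≤ c := fun z hz => by
    have hzc : z ∈ closure (ball (0 : ℂ) ‖z₀‖) := by
      rw [closure_ball _ hne]
      simp [hz]
    refine closure_minimal (t := closedBall (0 : ℂ) ‖z₁‖ ∩ (fun z => |f z|) ⁻¹' Iic c)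
      (fun y hy => ⟨?_, (hlt y hy).le⟩)
      (hcont.preimage_isClosed_of_isClosed isClosed_closedBall isClosed_Iic) hzc |>.2
    exact (closedBall_subset_closedBall hz₀') (ball_subset_closedBall hy)
  exact ⟨z₀, hsub hz₀, le_antisymm (hle z₀ rfl) hcz₀, hlt, hle⟩

/-- Where the imaginary part of a holomorphic function `L` with `L 0 = 0` first reaches `±πα/2`,
the value `z * L' z` is `±iαk` with `cosh (re (L z) / α) ≤ k`. -/
theorem mul_deriv_of_abs_im_eq {L : ℂ → ℂ} {z₀ L' : ℂ} {α : ℝ} (hα : 0 < α)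
    (hL : DifferentiableOn ℂ L (ball 0 ‖z₀‖)) (h0 : L 0 = 0)
    (hlt : ∀ z ∈ ball (0 : ℂ) ‖z₀‖, |(L z).im| < π * α / 2)
    (hle : ∀ z, ‖z‖ = ‖z₀‖ → |(L z).im| ≤ π * α / 2)
    {σ : ℝ} (hσ : σ = 1 ∨ σ = -1) (him : (L z₀).im = σ * (π * α / 2))
    (hd : HasDerivAt L L' z₀) :
    ∃ k, Real.cosh ((L z₀).re / α) ≤ k ∧ z₀ * L' = (σ * (α * k) : ℝ) * I := by
  have hpim : ∀ z, (L z / α).im = (L z).im / α := fun z => div_ofReal_im ..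
  have hpre : ∀ z, (L z / α).re = (L z).re / α := fun z => div_ofReal_re ..
  set x := (L z₀).re / α with hx
  have hcos : Real.cos (σ * (π / 2)) = 0 := by rcases hσ with rfl | rfl <;> simp
  have hsin : Real.sin (σ * (π / 2)) = σ := by rcases hσ with rfl | rfl <;> simp
  have hσ2 : σ * σ = 1 := by rcases hσ with rfl | rfl <;> norm_num
  have hang : (L z₀).im / α = σ * (π / 2) := by
    rw [him]
    field_simp
  have hre0 : (cexp (L z₀ / α)).re = 0 := by
    rw [Complex.exp_re, hpim, hang, hcos, mul_zero]
  have him0 : (cexp (L z₀ / α)).im = Real.exp x * σ := by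
    rw [Complex.exp_im, hpim, hpre, hang, hsin]
  have hexp : cexp (L z₀ / α) = (Real.exp x * σ : ℝ) * I := by
    apply Complex.ext
    · rw [hre0, re_ofReal_mul, I_re, mul_zero]
    · rw [him0, im_ofReal_mul, I_im, mul_one]
  obtain ⟨h1, h2⟩ := mul_deriv_of_re_eq_zero (p := fun z => cexp (L z / α))
    ((hL.div_const _).cexp) (by simp [h0])
    (fun z hz => by
      rw [Complex.exp_re, hpim]
      have := abs_lt.1 (hlt z hz)
      refine mul_pos (Real.exp_pos _) (Real.cos_pos_of_mem_Ioo ⟨?_, ?_⟩)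
      · rw [lt_div_iff₀ hα]
        linarith
      · rw [div_lt_iff₀ hα]
        linarith)
    (fun z hz => by
      rw [Complex.exp_re, hpim]
      have := abs_le.1 (hle z hz)
      refine mul_nonneg (Real.exp_pos _).le (Real.cos_nonneg_of_mem_Icc ⟨?_, ?_⟩)
      · rw [le_div_iff₀ hα]
        linarith
      · rw [div_le_iff₀ hα]
        linarith)
    hre0 ((hd.div_const _).cexp)
  have hE := Real.exp_pos x
  have hz : z₀ * (cexp (L z₀ / α) * (L' / α)) = (Real.exp x * σ / α : ℝ) * (I * (z₀ * L')) := by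
    rw [hexp]
    push_cast
    ring
  simp only [him0] at h2
  rw [hz] at h1 h2
  rw [im_ofReal_mul] at h1
  rw [re_ofReal_mul] at h2
  generalize z₀ * L' = w at h1 h2
  have hσ0 : σ ≠ 0 := by
    rintro rfl
    simp at hσ2
  refine ⟨σ * w.im / α, ?_, ?_⟩
  · simp at h2
    have h3 : Real.exp x * Real.exp (-x) = 1 := by rw [← Real.exp_add]; simp
    rw [Real.cosh_eq]
    have h4 : (1 + Real.exp x ^ 2) / 2 ≤ Real.exp x * (σ * w.im / α) := by
      have : (Real.exp x * σ) ^ 2 = Real.exp x ^ 2 := by rw [mul_pow, pow_two σ, hσ2, mul_one]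
      rw [this] at h2
      have e : Real.exp x * (σ * w.im / α) = Real.exp x * σ / α * w.im := by ring
      rw [e]
      linarith
    refine le_of_mul_le_mul_left ?_ hE
    linarith
  · have hw : w.re = 0 := by
      simpa [hα.ne', hσ0, hE.ne'] using h1
    apply Complex.ext
    · simpa using hw
    · simp
      field_simp
      linear_combination (-w.im) * hσ2

/-- Mocanu's theorem: if `q ∈ H[1,1]` is nonvanishing and
`|arg(q + zq'/q)| < πα/2 + arctan[α cos(πα/2)/((1−α)^{(1−α)/2}(1+α)^{(1+α)/2} + α sin(πα/2))]`,
then `|arg q| < πα/2`. -/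
theorem mocanu_theorem (α : ℝ) (hα0 : 0 < α) (hα1 : α < 1)
    (q : ℂ → ℂ)
    (hqd : DifferentiableOn ℂ q (ball 0 1))
    (hq0 : q 0 = 1)
    (hqne : ∀ z ∈ ball (0 : ℂ) 1, q z ≠ 0)
    (hne : ∀ z ∈ ball (0 : ℂ) 1, q z + z * deriv q z / q z ≠ 0)
    (harg : ∀ z ∈ ball (0 : ℂ) 1,
      |(q z + z * deriv q z / q z).arg| <
        π * α / 2 + Real.arctan (α * Real.cos (π * α / 2) /
          ((1 - α) ^ ((1 - α) / 2) * (1 + α) ^ ((1 + α) / 2)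
            + α * Real.sin (π * α / 2)))) :
    ∀ z ∈ ball (0 : ℂ) 1, |(q z).arg| < π * α / 2 := by
  obtain ⟨L, hL0, hL⟩ := exists_hasDerivAt_log_of_ne_zero one_pos hqd hq0 hqne
  have hc : 0 < π * α / 2 := by positivity
  suffices h : ∀ z ∈ ball (0 : ℂ) 1, |(L z).im| < π * α / 2 by
    intro z hz
    have hb := h z hz
    have hπ : π * α / 2 < π := by nlinarith [Real.pi_pos]
    have := abs_lt.1 hb
    rw [← (hL z hz).2, ← Complex.log_im, Complex.log_exp (by linarith) (by linarith)]
    exact hb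
  intro z₁ hz₁
  by_contra! hcon
  have hLd : DifferentiableOn ℂ L (ball 0 1) :=
    fun z hz => (hL z hz).1.differentiableAt.differentiableWithinAt
  obtain ⟨z₀, hz₀, heq, hlt, hle⟩ := exists_first_abs_eq (f := fun z => (L z).im)
    (Complex.continuous_im.comp_continuousOn hLd.continuousOn) (by simp [hL0]) hc hz₁ hcon
  obtain ⟨σ, hσ, him⟩ : ∃ σ : ℝ, (σ = 1 ∨ σ = -1) ∧ (L z₀).im = σ * (π * α / 2) := by
    rcases (abs_eq hc.le).1 heq with h | h
    · exact ⟨1, .inl rfl, by linarith⟩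
    · exact ⟨-1, .inr rfl, by linarith⟩
  have hz₀1 : ‖z₀‖ ≤ 1 := by simpa using (mem_ball_zero_iff.1 hz₀).le
  obtain ⟨k, hk, hzL⟩ := mul_deriv_of_abs_im_eq hα0 (hLd.mono (ball_subset_ball hz₀1)) hL0 hlt hle
    hσ him (hL z₀ hz₀).1
  have hF := harg z₀ hz₀
  have hG := le_arg_exp_add_mul_I hα0 hα1 hk
  have hLz : L z₀ = (α * ((L z₀).re / α) : ℝ) + (σ * (π * α / 2) : ℝ) * I := by
    rw [mul_div_cancel₀ _ hα0.ne', ← him, re_add_im]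
  rw [mul_div_assoc z₀, hzL, ← (hL z₀ hz₀).2] at hF
  refine absurd hF (not_lt.2 ?_)
  rcases hσ with rfl | rfl
  · rw [hLz]
    simp only [one_mul] at *
    exact hG.trans (le_abs_self _)
  · set w := cexp ((α * ((L z₀).re / α) : ℝ) + (π * α / 2 : ℝ) * I) + (α * k : ℝ) * I with hw
    have hconj : cexp (L z₀) + ((-1 * (α * k) : ℝ) : ℂ) * I = (starRingEnd ℂ) w := by
      rw [hLz, hw, map_add, ← Complex.exp_conj]
      simp only [map_add, map_mul, conj_ofReal, conj_I]
      push_cast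
      ring_nf
    have habs : |((starRingEnd ℂ) w).arg| = |w.arg| := by
      rw [Complex.arg_conj]
      split_ifs with h
      · rw [h]
      · exact abs_neg _
    rw [hconj, habs]
    exact hG.trans (le_abs_self _)
end
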